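/- arXiv:1706.00606 — 3 statements merged into one kernel-verified Lean document; each statement's English description precedes it below -/
import Mathlib

section
/- Let λ > 0. A function f : (0,∞) → ℝ is a generalized Stieltjes function of order λ (i.e., f(x) = c + ∫₀^∞ (x+t)^{-λ} dμ(t) with c ≥ 0 and μ a positive measure making the integral converge) if and only if f(x) = c + ∫₀^∞ e^{-xt} t^{λ-1} φ(t) dt for some completely monotonic function φ on (0,∞) and c ≥ 0. -/
open Real Set MeasureTheory

/-- A function is completely monotonic on `(0, ∞)`. -/
def CompletelyMonotonic (φ : ℝ → ℝ) : Prop :=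
  ContDiffOn ℝ (⊤ : ℕ∞) φ (Set.Ioi 0) ∧
    ∀ n : ℕ, ∀ x : ℝ, 0 < x → 0 ≤ (-1 : ℝ) ^ n * iteratedDerivWithin n φ (Set.Ioi 0) x

open Filter Topology
open scoped NNReal ENNReal CompactlySupported

theorem contDiffOn_Ioi_iteratedDerivWithin_eq {f : ℝ → ℝ}
    (hf : ContDiffOn ℝ (⊤ : ℕ∞) f (Ioi 0)) {a b x : ℝ} (hab : a < b) (ha : 0 < a)
    (hx : x ∈ Icc a b) (n : ℕ) :
    iteratedDerivWithin n f (Icc a b) x = iteratedDerivWithin n f (Ioi 0) x := by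
  have hx0 : 0 < x := ha.trans_le hx.1
  rw [iteratedDerivWithin_eq_iteratedDeriv (uniqueDiffOn_Icc hab) _ hx,
    iteratedDerivWithin_of_isOpen isOpen_Ioi hx0]
  exact (hf.contDiffAt (Ioi_mem_nhds hx0)).of_le (mod_cast le_top)

namespace CompletelyMonotonic

variable {φ : ℝ → ℝ}

theorem nonneg (h : CompletelyMonotonic φ) {x : ℝ} (hx : 0 < x) : 0 ≤ φ x := by
  simpa using h.2 0 x hx

/-- The terms of the Taylor series of a completely monotonic function, evaluated to the left of
the centre, are nonnegative. -/
theorem taylorTerm_nonneg (h : CompletelyMonotonic φ) {y c : ℝ} (hy : 0 < y) (hyc : y ≤ c)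
    (k : ℕ) :
    0 ≤ (-1 : ℝ) ^ k * iteratedDerivWithin k φ (Ioi 0) c / k.factorial * (c - y) ^ k := by
  have := h.2 k c (hy.trans_le hyc)
  have := sub_nonneg.2 hyc
  positivity

theorem taylorWithinEval_eq (h : CompletelyMonotonic φ) {y c : ℝ} (hy : 0 < y) (hyc : y < c)
    (n : ℕ) :
    taylorWithinEval φ n (Icc y c) c y = ∑ k ∈ Finset.range (n + 1),
      (-1 : ℝ) ^ k * iteratedDerivWithin k φ (Ioi 0) c / k.factorial * (c - y) ^ k := by
  rw [taylor_within_apply]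
  refine Finset.sum_congr rfl fun k _ => ?_
  rw [contDiffOn_Ioi_iteratedDerivWithin_eq h.1 hyc hy (right_mem_Icc.2 hyc.le), smul_eq_mul,
    show y - c = (-1) * (c - y) by ring, mul_pow]
  ring

theorem sum_taylor_le (h : CompletelyMonotonic φ) {y c : ℝ} (hy : 0 < y) (hyc : y < c) (n : ℕ) :
    ∑ k ∈ Finset.range (n + 1),
      (-1 : ℝ) ^ k * iteratedDerivWithin k φ (Ioi 0) c / k.factorial * (c - y) ^ k ≤ φ y := by
  have hsub : Icc y c ⊆ Ioi 0 := fun z hz => hy.trans_le hz.1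
  obtain ⟨ξ, hξ, e⟩ := taylor_mean_remainder_lagrange_iteratedDeriv (f := φ) (n := n) hyc.ne'
    (by rw [uIcc_of_ge hyc.le]; exact (h.1.mono hsub).of_le (mod_cast le_top))
  rw [uIoo_of_ge hyc.le] at hξ
  have hξ0 : 0 < ξ := hy.trans hξ.1
  rw [uIcc_of_ge hyc.le, h.taylorWithinEval_eq hy hyc,
    ← iteratedDerivWithin_of_isOpen isOpen_Ioi hξ0, show y - c = (-1) * (c - y) by ring,
    mul_pow] at e
  have h1 := h.2 (n + 1) ξ hξ0
  have h2 : 0 ≤ (c - y) ^ (n + 1) := pow_nonneg (sub_nonneg.2 hyc.le) _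
  have h3 : 0 ≤ ((-1 : ℝ) ^ (n + 1) * iteratedDerivWithin (n + 1) φ (Ioi 0) ξ) *
      (c - y) ^ (n + 1) / (n + 1).factorial := by positivity
  rw [← sub_nonneg, e]
  convert h3 using 1
  ring

/-- **Bernstein**: the Taylor series of a completely monotonic function around `c > 0` converges
to it on `(0, c)`. -/
theorem hasSum_taylor (h : CompletelyMonotonic φ) {y c : ℝ} (hy : 0 < y) (hyc : y < c) :
    HasSum (fun k : ℕ => (-1 : ℝ) ^ k * iteratedDerivWithin k φ (Ioi 0) c / k.factorial * (c - y) ^ k)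
      (φ y) := by
  rw [hasSum_iff_tendsto_nat_of_nonneg (h.taylorTerm_nonneg hy hyc.le),
    ← tendsto_add_atTop_iff_nat 1]
  have hsub : Icc y c ⊆ Ioi 0 := fun z hz => hy.trans_le hz.1
  set z := y / 2 with hz
  have hz0 : 0 < z := by positivity
  have hzy : z < y := by linarith
  set q := (c - y) / (c - z) with hq
  have hq0 : 0 ≤ q := div_nonneg (by linarith) (by linarith)
  have hq1 : q < 1 := (div_lt_one (by linarith)).2 (by linarith)
  set C := φ z * (c - y) / (y - z) with hC
  have key : ∀ n : ℕ, φ y - C * ((n + 1 : ℕ) * q ^ n) ≤ ∑ k ∈ Finset.range (n + 1),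
      (-1 : ℝ) ^ k * iteratedDerivWithin k φ (Ioi 0) c / k.factorial * (c - y) ^ k := by
    intro n
    obtain ⟨ξ, hξ, e⟩ := taylor_mean_remainder_cauchy (f := φ) (n := n) hyc.ne'
      (by rw [uIcc_of_ge hyc.le]; exact (h.1.mono hsub).of_le (mod_cast le_top))
      (by
        rw [uIcc_of_ge hyc.le, uIoo_of_ge hyc.le]
        exact ((h.1.mono hsub).differentiableOn_iteratedDerivWithin (m := n)
          (mod_cast WithTop.coe_lt_top _) (uniqueDiffOn_Icc hyc)).mono Ioo_subset_Icc_self)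
    rw [uIoo_of_ge hyc.le] at hξ
    have hξ0 : 0 < ξ := hy.trans hξ.1
    rw [uIcc_of_ge hyc.le, h.taylorWithinEval_eq hy hyc,
      contDiffOn_Ioi_iteratedDerivWithin_eq h.1 hyc hy (Ioo_subset_Icc_self hξ)] at e
    have hzξ : z < ξ := hzy.trans hξ.1
    have b1 : (-1 : ℝ) ^ (n + 1) * iteratedDerivWithin (n + 1) φ (Ioi 0) ξ / (n + 1).factorial *
        (ξ - z) ^ (n + 1) ≤ φ z :=
      (Finset.single_le_sum (fun k _ => h.taylorTerm_nonneg hz0 hzξ.le k)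
        (Finset.self_mem_range_succ (n + 1))).trans (h.sum_taylor_le hz0 hzξ (n + 1))
    have p1 : 0 < ξ - z := by linarith
    have p2 : 0 < ξ - y := by linarith [hξ.1]
    have b2 : (ξ - y) / (ξ - z) ≤ q := by
      rw [hq, div_le_div_iff₀ p1 (by linarith)]
      nlinarith [hξ.2]
    have b3 : ((ξ - y) / (ξ - z)) ^ n ≤ q ^ n := pow_le_pow_left₀ (by positivity) b2 n
    have p3 : 0 < c - y := by linarith
    have p4 : 0 < y - z := by linarith
    have b4 : (c - y) / (ξ - z) ≤ (c - y) / (y - z) :=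
      div_le_div_of_nonneg_left p3.le p4 (by linarith [hξ.1])
    have hφ := h.nonneg hz0
    have e2 : φ y - ∑ k ∈ Finset.range (n + 1),
      (-1 : ℝ) ^ k * iteratedDerivWithin k φ (Ioi 0) c / k.factorial * (c - y) ^ k =
      ((-1 : ℝ) ^ (n + 1) * iteratedDerivWithin (n + 1) φ (Ioi 0) ξ / (n + 1).factorial *
        (ξ - z) ^ (n + 1)) * ((n + 1 : ℕ) * ((ξ - y) / (ξ - z)) ^ n * ((c - y) / (ξ - z))) := by
      rw [e, show y - ξ = (-1) * (ξ - y) by ring, mul_pow, div_pow, Nat.factorial_succ]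
      push_cast
      field_simp
      ring
    have : φ y - ∑ k ∈ Finset.range (n + 1),
      (-1 : ℝ) ^ k * iteratedDerivWithin k φ (Ioi 0) c / k.factorial * (c - y) ^ k ≤
        φ z * ((n + 1 : ℕ) * q ^ n * ((c - y) / (y - z))) := by
      rw [e2]
      gcongr
    have e3 : φ z * ((n + 1 : ℕ) * q ^ n * ((c - y) / (y - z))) = C * ((n + 1 : ℕ) * q ^ n) := by
      rw [hC]; ring
    linarith
  refine tendsto_of_tendsto_of_tendsto_of_le_of_le ?_ tendsto_const_nhds key
    (h.sum_taylor_le hy hyc)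
  have t : Tendsto (fun n : ℕ => ((n + 1 : ℕ) : ℝ) * q ^ n) atTop (𝓝 0) := by
    have := (tendsto_self_mul_const_pow_of_lt_one hq0 hq1).add
      (tendsto_pow_atTop_nhds_zero_of_lt_one hq0 hq1)
    simpa [add_mul] using this
  simpa using (tendsto_const_nhds (x := φ y)).sub (t.const_mul C)

end CompletelyMonotonic

theorem integrable_and_integral_eq_of_lintegral_ofReal {α : Type*} [MeasurableSpace α]
    {μ : Measure α} {f : α → ℝ} (hf : AEStronglyMeasurable f μ) (h0 : 0 ≤ᵐ[μ] f) {r : ℝ}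
    (hr : 0 ≤ r) (h : ∫⁻ a, ENNReal.ofReal (f a) ∂μ = ENNReal.ofReal r) :
    Integrable f μ ∧ ∫ a, f a ∂μ = r := by
  constructor
  · rw [← lintegral_ofReal_ne_top_iff_integrable hf h0, h]
    exact ENNReal.ofReal_ne_top
  · rw [integral_eq_lintegral_of_nonneg_ae h0 hf, h, ENNReal.toReal_ofReal hr]

/-- A continuous cutoff function on `ℝ≥0`, equal to `1` on `[0, m]` and vanishing outside
`[0, m + 1]`. -/
noncomputable def laplaceCutoff (m : ℕ) (s : ℝ≥0) : ℝ := max 0 (min 1 (m + 1 - s))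

theorem continuous_laplaceCutoff (m : ℕ) : Continuous (laplaceCutoff m) := by
  unfold laplaceCutoff; fun_prop

theorem laplaceCutoff_nonneg (m : ℕ) (s : ℝ≥0) : 0 ≤ laplaceCutoff m s := le_max_left _ _

theorem laplaceCutoff_le_one (m : ℕ) (s : ℝ≥0) : laplaceCutoff m s ≤ 1 :=
  max_le zero_le_one (min_le_left _ _)

theorem laplaceCutoff_eq_one {m : ℕ} {s : ℝ≥0} (h : (s : ℝ) ≤ m) : laplaceCutoff m s = 1 := by
  unfold laplaceCutoff
  rw [min_eq_left (by linarith), max_eq_right zero_le_one]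

theorem monotone_laplaceCutoff (s : ℝ≥0) : Monotone fun m => laplaceCutoff m s := by
  intro m n hmn
  have : (m : ℝ) ≤ n := mod_cast hmn
  exact max_le_max le_rfl (min_le_min le_rfl (by linarith))

theorem hasCompactSupport_laplaceCutoff (m : ℕ) : HasCompactSupport (laplaceCutoff m) := by
  refine HasCompactSupport.intro (K := Icc 0 (m + 1 : ℝ≥0)) isCompact_Icc fun s hs => ?_
  have : (m + 1 : ℝ≥0) < s := by simpa using hs
  have : (m + 1 : ℝ) < s := mod_cast this
  unfold laplaceCutoff
  rw [max_eq_left]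
  exact (min_le_right _ _).trans (by linarith)

/-- The exponential `s ↦ exp (-(x * s))`, cut off to a compactly supported function. -/
noncomputable def truncatedExp (x : ℝ) (m : ℕ) : C_c(ℝ≥0, ℝ) where
  toFun s := laplaceCutoff m s * exp (-(x * s))
  continuous_toFun := by
    have := continuous_laplaceCutoff m
    fun_prop
  hasCompactSupport' := (hasCompactSupport_laplaceCutoff m).mul_right

theorem truncatedExp_apply (x : ℝ) (m : ℕ) (s : ℝ≥0) :
    truncatedExp x m s = laplaceCutoff m s * exp (-(x * s)) := rfl

theorem truncatedExp_nonneg (x : ℝ) (m : ℕ) (s : ℝ≥0) : 0 ≤ truncatedExp x m s :=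
  mul_nonneg (laplaceCutoff_nonneg m s) (exp_pos _).le

theorem truncatedExp_le (x : ℝ) (m : ℕ) (s : ℝ≥0) : truncatedExp x m s ≤ exp (-(x * s)) :=
  mul_le_of_le_one_left (exp_pos _).le (laplaceCutoff_le_one m s)

theorem le_truncatedExp {x : ℝ} (hx : 0 < x) (m : ℕ) (s : ℝ≥0) :
    exp (-(x * s)) - exp (-(x / 2 * m)) * exp (-(x / 2 * s)) ≤ truncatedExp x m s := by
  rcases le_or_gt (s : ℝ) m with h | h
  · rw [truncatedExp_apply, laplaceCutoff_eq_one h, one_mul, sub_le_self_iff]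
    positivity
  · refine le_trans ?_ (truncatedExp_nonneg x m s)
    rw [sub_nonpos, ← exp_add]
    gcongr
    nlinarith

theorem exists_norm_le_mul_exp_neg (g : C_c(ℝ≥0, ℝ)) :
    ∃ C : ℝ, ∀ s, ‖g s‖ ≤ C * exp (-(1 * (s : ℝ))) := by
  obtain ⟨C, hC⟩ := (g.hasCompactSupport.mul_right
    (f' := fun s : ℝ≥0 => exp (s : ℝ))).exists_bound_of_continuous
    (g.continuous.mul (by fun_prop))
  refine ⟨C, fun s => ?_⟩
  have := hC s
  rw [Pi.mul_apply, norm_mul, norm_of_nonneg (exp_pos _).le] at this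
  rwa [one_mul, exp_neg, ← div_eq_mul_inv, le_div_iff₀ (exp_pos _)]

/-- **Continuity theorem** for Laplace transforms: a pointwise limit on `(0, ∞)` of Laplace
transforms of measures on `[0, ∞)` is the Laplace transform of a measure. -/
theorem exists_measure_laplace_of_tendsto (ν : ℕ → Measure ℝ≥0) (F : ℕ → ℝ → ℝ) (φ : ℝ → ℝ)
    (hF : ∀ n x, 0 < x → 0 ≤ F n x)
    (hν : ∀ n x, 0 < x →
      ∫⁻ s : ℝ≥0, ENNReal.ofReal (exp (-(x * s))) ∂(ν n) = ENNReal.ofReal (F n x))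
    (hlim : ∀ x, 0 < x → Tendsto (fun n => F n x) atTop (𝓝 (φ x))) :
    ∃ ρ : Measure ℝ≥0, SFinite ρ ∧ ∀ x, 0 < x →
      ∫⁻ s : ℝ≥0, ENNReal.ofReal (exp (-(x * s))) ∂ρ = ENNReal.ofReal (φ x) := by
  have hexp : ∀ n x, 0 < x → Integrable (fun s : ℝ≥0 => exp (-(x * s))) (ν n) ∧
      ∫ s : ℝ≥0, exp (-(x * s)) ∂(ν n) = F n x := fun n x hx =>
    integrable_and_integral_eq_of_lintegral_ofReal (by fun_prop)
      (Eventually.of_forall fun s => (exp_pos _).le) (hF n x hx) (hν n x hx)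
  have hInt : ∀ n (g : C_c(ℝ≥0, ℝ)), Integrable g (ν n) := fun n g => by
    obtain ⟨C, hC⟩ := exists_norm_le_mul_exp_neg g
    exact ((hexp n 1 one_pos).1.const_mul C).mono' g.continuous.aestronglyMeasurable
      (Eventually.of_forall hC)
  let U : Ultrafilter ℕ := hyperfilter ℕ
  have hU : (U : Filter ℕ) ≤ atTop := Nat.hyperfilter_le_atTop
  have L : ∀ g : C_c(ℝ≥0, ℝ), ∃ l, Tendsto (fun n => ∫ s, g s ∂(ν n)) U (𝓝 l) := fun g => by
    obtain ⟨C, hC⟩ := exists_norm_le_mul_exp_neg g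
    have hb : ∀ n, ‖∫ s, g s ∂(ν n)‖ ≤ C * F n 1 := fun n => by
      rw [← (hexp n 1 one_pos).2, ← integral_const_mul]
      exact norm_integral_le_of_norm_le ((hexp n 1 one_pos).1.const_mul C)
        (Eventually.of_forall hC)
    have he : ∀ᶠ n in (U : Filter ℕ), ∫ s, g s ∂(ν n) ∈
        Icc (-(C * φ 1 + 1)) (C * φ 1 + 1) := by
      filter_upwards [hU (((hlim 1 one_pos).const_mul C).eventually_le_const
        (lt_add_one (C * φ 1)))] with n hn
      exact abs_le.1 ((hb n).trans hn)
    obtain ⟨l, -, hl⟩ := isCompact_Icc.ultrafilter_le_nhds'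
      (U.map fun n => ∫ s, g s ∂(ν n)) he
    exact ⟨l, hl⟩
  choose Λ hΛ using L
  let Λl : C_c(ℝ≥0, ℝ) →ₗ[ℝ] ℝ :=
    { toFun := Λ
      map_add' := fun f g => by
        refine tendsto_nhds_unique (hΛ (f + g)) (((hΛ f).add (hΛ g)).congr fun n => ?_)
        rw [← integral_add (hInt n f) (hInt n g)]
        rfl
      map_smul' := fun c f => by
        refine tendsto_nhds_unique (hΛ (c • f)) (((hΛ f).const_mul c).congr fun n => ?_)
        rw [← integral_const_mul]
        rfl }
  let Λp : C_c(ℝ≥0, ℝ) →ₚ[ℝ] ℝ := PositiveLinearMap.mk₀ Λl fun f hf =>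
    ge_of_tendsto (hΛ f) (Eventually.of_forall fun n => integral_nonneg fun s => hf s)
  have hΛp : ∀ g, ∫ s, g s ∂(RealRMK.rieszMeasure Λp) = Λ g := RealRMK.integral_rieszMeasure Λp
  have : IsFiniteMeasureOnCompacts (RealRMK.rieszMeasure Λp) := by infer_instance
  refine ⟨RealRMK.rieszMeasure Λp, inferInstance, fun x hx => ?_⟩
  have hx2 : 0 < x / 2 := by positivity
  have upper : ∀ m, Λ (truncatedExp x m) ≤ φ x := fun m => by
    refine le_of_tendsto_of_tendsto' (hΛ _) ((hlim x hx).mono_left hU) fun n => ?_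
    rw [← (hexp n x hx).2]
    exact integral_mono (hInt n _) (hexp n x hx).1 (truncatedExp_le x m)
  have lower : ∀ m : ℕ, φ x - exp (-(x / 2 * m)) * φ (x / 2) ≤ Λ (truncatedExp x m) := fun m => by
    refine le_of_tendsto_of_tendsto' (((hlim x hx).sub
      ((hlim (x / 2) hx2).const_mul (exp (-(x / 2 * m))))).mono_left hU) (hΛ _) fun n => ?_
    rw [← (hexp n x hx).2, ← (hexp n (x / 2) hx2).2, ← integral_const_mul,
      ← integral_sub (hexp n x hx).1 ((hexp n (x / 2) hx2).1.const_mul _)]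
    exact integral_mono ((hexp n x hx).1.sub ((hexp n (x / 2) hx2).1.const_mul _)) (hInt n _)
      (le_truncatedExp hx m)
  have t0 : Tendsto (fun m : ℕ => exp (-(x / 2 * m))) atTop (𝓝 0) :=
    tendsto_exp_neg_atTop_nhds_zero.comp (tendsto_natCast_atTop_atTop.const_mul_atTop hx2)
  have t1 : Tendsto (fun m => Λ (truncatedExp x m)) atTop (𝓝 (φ x)) :=
    tendsto_of_tendsto_of_tendsto_of_le_of_le
      (by simpa using (tendsto_const_nhds (x := φ x)).sub (t0.mul_const (φ (x / 2))))
      tendsto_const_nhds lower upper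
  have t2 : Tendsto (fun m => ∫⁻ s, ENNReal.ofReal (truncatedExp x m s)
      ∂(RealRMK.rieszMeasure Λp)) atTop (𝓝 (ENNReal.ofReal (φ x))) := by
    refine (ENNReal.tendsto_ofReal t1).congr fun m => ?_
    rw [← hΛp]
    exact ofReal_integral_eq_lintegral_ofReal
      ((truncatedExp x m).continuous.integrable_of_hasCompactSupport
        (truncatedExp x m).hasCompactSupport)
      (Eventually.of_forall (truncatedExp_nonneg x m))
  refine tendsto_nhds_unique (lintegral_tendsto_of_tendsto_of_monotone
    (fun m => ?_) (Eventually.of_forall fun s m n hmn => ?_)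
    (Eventually.of_forall fun s => ?_)) t2
  · exact ((truncatedExp x m).continuous.measurable.ennreal_ofReal).aemeasurable
  · exact ENNReal.ofReal_le_ofReal (mul_le_mul_of_nonneg_right (monotone_laplaceCutoff s hmn)
      (exp_pos _).le)
  · obtain ⟨N, hN⟩ := exists_nat_ge (s : ℝ)
    refine tendsto_const_nhds.congr' ?_
    filter_upwards [eventually_ge_atTop N] with m hm
    rw [truncatedExp_apply, laplaceCutoff_eq_one (hN.trans (mod_cast hm)), one_mul]

/-- **Bernstein's theorem**: a completely monotonic function is the Laplace transform of a measure
on `[0, ∞)`. -/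
theorem CompletelyMonotonic.exists_measure_laplace {φ : ℝ → ℝ} (h : CompletelyMonotonic φ) :
    ∃ ρ : Measure ℝ≥0, SFinite ρ ∧ ∀ x, 0 < x →
      ∫⁻ s : ℝ≥0, ENNReal.ofReal (exp (-(x * s))) ∂ρ = ENNReal.ofReal (φ x) := by
  let N : ℕ → ℝ := fun n => n + 1
  have hN : ∀ n, 0 < N n := fun n => by positivity
  let a : ℕ → ℕ → ℝ := fun n k =>
    (-1 : ℝ) ^ k * iteratedDerivWithin k φ (Ioi 0) (N n) / k.factorial * N n ^ k
  have ha : ∀ n k, 0 ≤ a n k := fun n k => by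
    have := h.2 k (N n) (hN n)
    have := hN n
    positivity
  let p : ℕ → ℝ → ℝ := fun n x => N n * (1 - exp (-(x / N n)))
  have hp0 : ∀ n x, 0 < x → 0 < p n x := fun n x hx => by
    have : exp (-(x / N n)) < 1 := exp_lt_one_iff.2 (neg_neg_iff_pos.2 (div_pos hx (hN n)))
    exact mul_pos (hN n) (by linarith)
  have hpN : ∀ n x, p n x < N n := fun n x =>
    mul_lt_of_lt_one_right (hN n) (by linarith [exp_pos (-(x / N n))])
  have hsum : ∀ n x, 0 < x → HasSum (fun k : ℕ => a n k * exp (-(x * (k / N n)))) (φ (p n x)) :=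
    fun n x hx => by
      convert h.hasSum_taylor (hp0 n x hx) (hpN n x) using 2 with k
      rw [show N n - p n x = N n * exp (-(x / N n)) by simp only [p]; ring, mul_pow, ← exp_nat_mul,
        show (k : ℝ) * -(x / N n) = -(x * (k / N n)) by ring]
      simp only [a]
      ring
  refine exists_measure_laplace_of_tendsto
    (fun n => Measure.sum fun k : ℕ => ENNReal.ofReal (a n k) •
      Measure.dirac ((k : ℝ≥0) / (n + 1))) (fun n x => φ (p n x)) φ
    (fun n x hx => h.nonneg (hp0 n x hx)) (fun n x hx => ?_) fun x hx => ?_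
  · rw [lintegral_sum_measure, ← (hsum n x hx).tsum_eq, ENNReal.ofReal_tsum_of_nonneg
      (fun k => mul_nonneg (ha n k) (exp_pos _).le) (hsum n x hx).summable]
    refine tsum_congr fun k => ?_
    rw [lintegral_smul_measure, lintegral_dirac, ENNReal.ofReal_mul (ha n k), smul_eq_mul]
    simp [N]
  · have hc : ContinuousAt φ x := h.1.continuousOn.continuousAt (Ioi_mem_nhds hx)
    refine hc.tendsto.comp ?_
    have t : Tendsto (fun n => x / N n) atTop (𝓝 0) :=
      tendsto_const_nhds.div_atTop (tendsto_natCast_atTop_atTop.atTop_add tendsto_const_nhds)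
    refine tendsto_of_tendsto_of_tendsto_of_le_of_le (g := fun n => x / (1 + x / N n))
      (h := fun _ => x) ?_ tendsto_const_nhds (fun n => ?_) fun n => ?_
    · have := Tendsto.div (tendsto_const_nhds (x := x)) (t.const_add 1) (by norm_num)
      rw [add_zero, div_one] at this
      exact this
    · have hu : 0 < x / N n := div_pos hx (hN n)
      have h1 : exp (-(x / N n)) ≤ 1 / (1 + x / N n) := by
        rw [exp_neg, ← one_div]
        exact one_div_le_one_div_of_le (by positivity) (by linarith [add_one_le_exp (x / N n)])
      calc x / (1 + x / N n) = N n * (1 - 1 / (1 + x / N n)) := by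
            have := hN n
            field_simp
            ring
        _ ≤ p n x := mul_le_mul_of_nonneg_left (by linarith) (hN n).le
    · calc p n x ≤ N n * (x / N n) := mul_le_mul_of_nonneg_left
            (by linarith [one_sub_le_exp_neg (x / N n)]) (hN n).le
        _ = x := mul_div_cancel₀ _ (hN n).ne'

/-- A function which is on `(0, ∞)` the (convergent) Laplace transform of a measure on `[0, ∞)` is
completely monotonic. -/
theorem completelyMonotonic_laplace {ρ : Measure ℝ} (h0 : ∀ᵐ s ∂ρ, 0 ≤ s)
    (hρ : ∀ x, 0 < x → Integrable (fun s => exp (-(x * s))) ρ) :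
    CompletelyMonotonic fun x => ∫ s, exp (-(x * s)) ∂ρ := by
  have e : (fun x => ∫ s, exp (-(x * s)) ∂ρ) = ProbabilityTheory.mgf (fun s => -s) ρ := by
    ext x
    simp [ProbabilityTheory.mgf]
  have hsub : Ioi 0 ⊆ interior (ProbabilityTheory.integrableExpSet (fun s => -s) ρ) := by
    refine interior_maximal (fun x hx => ?_) isOpen_Ioi
    simpa [ProbabilityTheory.integrableExpSet] using hρ x hx
  rw [e]
  refine ⟨((ProbabilityTheory.analyticOnNhd_mgf (X := fun s => -s)).mono hsub).contDiffOn
    isOpen_Ioi.uniqueDiffOn, fun n x hx => ?_⟩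
  rw [iteratedDerivWithin_of_isOpen isOpen_Ioi hx, ProbabilityTheory.iteratedDeriv_mgf (hsub hx),
    ← integral_const_mul]
  refine integral_nonneg_of_ae ?_
  filter_upwards [h0] with s hs
  rw [← mul_assoc, ← mul_pow]
  have : 0 ≤ -1 * -s := by linarith
  positivity

theorem lintegral_exp_mul_rpow {a r : ℝ} (ha : 0 < a) (hr : 0 < r) :
    ∫⁻ t in Ioi 0, ENNReal.ofReal (exp (-(r * t)) * t ^ (a - 1)) =
      ENNReal.ofReal (Gamma a) * ENNReal.ofReal (r ^ (-a)) := by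
  have key := integral_rpow_mul_exp_neg_mul_Ioi ha hr
  have hpos : 0 < (1 / r) ^ a * Gamma a := mul_pos (by positivity) (Gamma_pos_of_pos ha)
  rw [← ENNReal.ofReal_mul (Gamma_pos_of_pos ha).le, rpow_neg hr.le, ← inv_rpow hr.le, ← one_div,
    mul_comm (Gamma a), ← key, ofReal_integral_eq_lintegral_ofReal]
  · simp_rw [mul_comm]
  · by_contra hni
    rw [integral_undef hni] at key
    exact hpos.ne key
  · filter_upwards [ae_restrict_mem measurableSet_Ioi] with t ht
    have : (0 : ℝ) < t := ht
    positivity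

/-- The Laplace transform of `t ^ (a - 1)` times the Laplace transform of `ρ` is, up to a factor
`Gamma a`, the generalized Stieltjes transform of order `a` of `ρ`. -/
theorem lintegral_exp_mul_rpow_mul_laplace {ρ : Measure ℝ} [SFinite ρ] (h0 : ∀ᵐ s ∂ρ, 0 ≤ s)
    {φ : ℝ → ℝ}
    (hφ : ∀ t, 0 < t → ∫⁻ s, ENNReal.ofReal (exp (-(t * s))) ∂ρ = ENNReal.ofReal (φ t))
    {a x : ℝ} (ha : 0 < a) (hx : 0 < x) :
    ∫⁻ t in Ioi 0, ENNReal.ofReal (exp (-x * t) * t ^ (a - 1) * φ t) =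
      ENNReal.ofReal (Gamma a) * ∫⁻ s, ENNReal.ofReal ((x + s) ^ (-a)) ∂ρ := by
  calc ∫⁻ t in Ioi 0, ENNReal.ofReal (exp (-x * t) * t ^ (a - 1) * φ t)
      = ∫⁻ t in Ioi 0, ∫⁻ s, ENNReal.ofReal (exp (-((x + s) * t)) * t ^ (a - 1)) ∂ρ := by
        refine setLIntegral_congr_fun measurableSet_Ioi fun t ht => ?_
        have ht0 : (0 : ℝ) < t := ht
        have hk : 0 ≤ exp (-x * t) * t ^ (a - 1) := by positivity
        rw [ENNReal.ofReal_mul hk, ← hφ t ht, ← lintegral_const_mul _ (by fun_prop)]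
        refine lintegral_congr fun s => ?_
        rw [← ENNReal.ofReal_mul hk, mul_right_comm, ← exp_add]
        ring_nf
    _ = ∫⁻ s, (∫⁻ t in Ioi 0, ENNReal.ofReal (exp (-((x + s) * t)) * t ^ (a - 1))) ∂ρ :=
        lintegral_lintegral_swap (by fun_prop)
    _ = ∫⁻ s, ENNReal.ofReal (Gamma a) * ENNReal.ofReal ((x + s) ^ (-a)) ∂ρ := by
        refine lintegral_congr_ae ?_
        filter_upwards [h0] with s hs
        exact lintegral_exp_mul_rpow ha (by linarith)
    _ = _ := lintegral_const_mul _ (by fun_prop)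

theorem sFinite_of_integrable_pos {α : Type*} [MeasurableSpace α] {μ : Measure α} {f : α → ℝ}
    (hf : Measurable f) (hpos : ∀ᵐ a ∂μ, 0 < f a) (hInt : Integrable f μ) : SFinite μ := by
  have : IsFiniteMeasure (μ.withDensity fun a => ENNReal.ofReal (f a)) :=
    isFiniteMeasure_withDensity_ofReal hInt.2
  rw [← withDensity_inv_same (μ := μ) hf.ennreal_ofReal
    (by filter_upwards [hpos] with a ha; simpa using ha)
    (Eventually.of_forall fun a => ENNReal.ofReal_ne_top)]
  infer_instance

/-- The exponential decays faster than any power. -/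
theorem exists_exp_neg_le_mul_rpow (a : ℝ) {t : ℝ} (ht : 0 < t) :
    ∃ C : ℝ, ∀ s, 0 ≤ s → exp (-(t * s)) ≤ C * (1 + s) ^ (-a) := by
  have hlim : Tendsto (fun s : ℝ => s ^ a * exp (-t * s)) atTop (𝓝 0) :=
    tendsto_rpow_mul_exp_neg_mul_atTop_nhds_zero a t ht
  obtain ⟨M, hM⟩ := eventually_atTop.1 (hlim.eventually_le_const one_pos)
  have hcont : ContinuousOn (fun s : ℝ => s ^ a * exp (-t * s)) (Icc 1 (max M 1)) := fun s hs =>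
    ((continuousAt_rpow_const s a (Or.inl (by linarith [hs.1]))).mul
      (by fun_prop)).continuousWithinAt
  obtain ⟨C, hC⟩ := isCompact_Icc.exists_bound_of_continuousOn hcont
  refine ⟨max C 1 * exp t, fun s hs => ?_⟩
  have hs1 : 0 < 1 + s := by linarith
  have hb : (1 + s) ^ a * exp (-t * (1 + s)) ≤ max C 1 := by
    rcases le_total (1 + s) (max M 1) with h | h
    · exact (le_norm_self _).trans ((hC _ ⟨by linarith, h⟩).trans (le_max_left _ _))
    · exact (hM _ ((le_max_left _ _).trans h)).trans (le_max_right _ _)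
  calc exp (-(t * s)) = (1 + s) ^ a * exp (-t * (1 + s)) * (exp t * (1 + s) ^ (-a)) := by
        rw [rpow_neg hs1.le, show exp (-(t * s)) = exp (-t * (1 + s)) * exp t by
          rw [← exp_add]; ring_nf]
        field_simp
    _ ≤ max C 1 * (exp t * (1 + s) ^ (-a)) := by gcongr
    _ = _ := by ring

theorem generalized_stieltjes_iff_laplace (lam : ℝ) (hlam : 0 < lam) (f : ℝ → ℝ) :
    (∃ c : ℝ, 0 ≤ c ∧ ∃ μ : Measure ℝ,
        (∀ x : ℝ, 0 < x → IntegrableOn (fun t => (x + t) ^ (-lam)) (Set.Ici 0) μ) ∧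
        (∀ x : ℝ, 0 < x → f x = c + ∫ t in Set.Ici 0, (x + t) ^ (-lam) ∂μ))
    ↔
    (∃ c : ℝ, 0 ≤ c ∧ ∃ φ : ℝ → ℝ, CompletelyMonotonic φ ∧
        (∀ x : ℝ, 0 < x →
          IntegrableOn (fun t => Real.exp (-x * t) * t ^ (lam - 1) * φ t) (Set.Ioi 0)) ∧
        (∀ x : ℝ, 0 < x →
          f x = c + ∫ t in Set.Ioi 0, Real.exp (-x * t) * t ^ (lam - 1) * φ t)) := by
  have hΓ := Gamma_pos_of_pos hlam
  constructor
  · rintro ⟨c, hc, μ, hInt, hf⟩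
    set ν : Measure ℝ := μ.restrict (Ici 0) with hν
    have h0 : ∀ᵐ s ∂ν, 0 ≤ s := ae_restrict_mem measurableSet_Ici
    have hsf : SFinite ν := sFinite_of_integrable_pos (f := fun s => (1 + s) ^ (-lam))
      (by fun_prop) (by filter_upwards [h0] with s hs; positivity) (hInt 1 one_pos)
    set ρ : Measure ℝ := ENNReal.ofReal (Gamma lam)⁻¹ • ν with hρ
    have h0ρ : ∀ᵐ s ∂ρ, 0 ≤ s := Measure.ae_smul_measure h0 _
    have hexp : ∀ t, 0 < t → Integrable (fun s => exp (-(t * s))) ρ := fun t ht => by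
      obtain ⟨C, hC⟩ := exists_exp_neg_le_mul_rpow lam ht
      refine Integrable.smul_measure (((hInt 1 one_pos).const_mul C).mono' (by fun_prop) ?_)
        ENNReal.ofReal_ne_top
      filter_upwards [h0] with s hs
      rw [norm_of_nonneg (exp_pos _).le]
      exact hC s hs
    have hcm := completelyMonotonic_laplace h0ρ hexp
    set φ : ℝ → ℝ := fun x => ∫ s, exp (-(x * s)) ∂ρ with hφ
    have key : ∀ x, 0 < x → ∫⁻ t in Ioi 0, ENNReal.ofReal (exp (-x * t) * t ^ (lam - 1) * φ t) =
        ENNReal.ofReal (∫ t in Ici 0, (x + t) ^ (-lam) ∂μ) := fun x hx => by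
      rw [lintegral_exp_mul_rpow_mul_laplace h0ρ (fun t ht =>
        (ofReal_integral_eq_lintegral_ofReal (hexp t ht)
          (Eventually.of_forall fun s => (exp_pos _).le)).symm) hlam hx, hρ,
        lintegral_smul_measure, smul_eq_mul, ← mul_assoc, ← ENNReal.ofReal_mul hΓ.le,
        mul_inv_cancel₀ hΓ.ne', ENNReal.ofReal_one, one_mul,
        ofReal_integral_eq_lintegral_ofReal (hInt x hx)]
      filter_upwards [h0] with s hs
      positivity
    have key' : ∀ x, 0 < x → Integrable (fun t => exp (-x * t) * t ^ (lam - 1) * φ t)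
        (volume.restrict (Ioi 0)) ∧ ∫ t in Ioi 0, exp (-x * t) * t ^ (lam - 1) * φ t =
          ∫ t in Ici 0, (x + t) ^ (-lam) ∂μ := fun x hx => by
      refine integrable_and_integral_eq_of_lintegral_ofReal ?_ ?_ ?_ (key x hx)
      · exact AEStronglyMeasurable.mul (by fun_prop)
          (hcm.1.continuousOn.aestronglyMeasurable measurableSet_Ioi)
      · filter_upwards [ae_restrict_mem measurableSet_Ioi] with t ht
        have ht0 : (0 : ℝ) < t := ht
        have := hcm.nonneg ht0
        positivity
      · refine integral_nonneg_of_ae ?_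
        filter_upwards [h0] with s hs
        positivity
    exact ⟨c, hc, φ, hcm, fun x hx => (key' x hx).1, fun x hx => by rw [hf x hx, (key' x hx).2]⟩
  · rintro ⟨c, hc, φ, hcm, hInt, hf⟩
    obtain ⟨ρ, hsf, hρ⟩ := hcm.exists_measure_laplace
    set σ : Measure ℝ := ρ.map ((↑) : ℝ≥0 → ℝ) with hσ
    have h0 : ∀ᵐ s ∂σ, 0 ≤ s :=
      (ae_map_iff (by fun_prop) measurableSet_Ici).2 (Eventually.of_forall fun s => s.2)
    have hσφ : ∀ t, 0 < t → ∫⁻ s, ENNReal.ofReal (exp (-(t * s))) ∂σ = ENNReal.ofReal (φ t) :=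
      fun t ht => by rw [hσ, lintegral_map (by fun_prop) (by fun_prop), hρ t ht]
    have hr : (ENNReal.ofReal (Gamma lam) • σ).restrict (Ici 0) =
        ENNReal.ofReal (Gamma lam) • σ :=
      Measure.restrict_eq_self_of_ae_mem (Measure.ae_smul_measure h0 _)
    have key : ∀ x, 0 < x →
        Integrable (fun t => (x + t) ^ (-lam)) (ENNReal.ofReal (Gamma lam) • σ) ∧
        ∫ t, (x + t) ^ (-lam) ∂(ENNReal.ofReal (Gamma lam) • σ) =
          ∫ t in Ioi 0, exp (-x * t) * t ^ (lam - 1) * φ t := fun x hx => by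
      have hnn : ∀ᵐ t ∂(volume.restrict (Ioi 0)), 0 ≤ exp (-x * t) * t ^ (lam - 1) * φ t := by
        filter_upwards [ae_restrict_mem measurableSet_Ioi] with t ht
        have ht0 : (0 : ℝ) < t := ht
        have := hcm.nonneg ht0
        positivity
      refine integrable_and_integral_eq_of_lintegral_ofReal
        (Measurable.aestronglyMeasurable (by fun_prop)) ?_ (integral_nonneg_of_ae hnn) ?_
      · refine Measure.ae_smul_measure ?_ _
        filter_upwards [h0] with s hs
        positivity
      · rw [lintegral_smul_measure, smul_eq_mul,
          ← lintegral_exp_mul_rpow_mul_laplace h0 hσφ hlam hx,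
          ofReal_integral_eq_lintegral_ofReal (hInt x hx) hnn]
    refine ⟨c, hc, ENNReal.ofReal (Gamma lam) • σ, fun x hx => ?_, fun x hx => ?_⟩
    · rw [IntegrableOn, hr]
      exact (key x hx).1
    · rw [hr, (key x hx).2, hf x hx]
end

section
/- Let λ > 0 and let f be a smooth function on (0,∞). If the function c^λ_k(f)(x) = x^{1-λ}(x^{λ-1+k}f(x))^{(k)} is completely monotonic for every k ≥ 0, then f is a generalized Stieltjes function of order λ. -/
open Real Set MeasureTheory

open Filter Topology
open scoped ENNReal NNReal

/-- The functions `g n` are nonnegative on `(0, ∞)` and `g n` is `(-1) ^ n` times the `n`-th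
derivative of `g 0` there. -/
structure AlternatingDerivs (g : ℕ → ℝ → ℝ) : Prop where
  hasDerivAt : ∀ n x, 0 < x → HasDerivAt (g n) (-g (n + 1) x) x
  nonneg : ∀ n x, 0 < x → 0 ≤ g n x

theorem lintegral_Ioi_of_hasDerivAt_neg {h h' : ℝ → ℝ} {x L : ℝ}
    (hd : ∀ y ∈ Ici x, HasDerivAt h (-h' y) y) (hp : ∀ y ∈ Ioi x, 0 ≤ h' y)
    (hL : Tendsto h atTop (𝓝 L)) :
    ∫⁻ y in Ioi x, ENNReal.ofReal (h' y) = ENNReal.ofReal (h x - L) := by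
  have hneg : ∀ y ∈ Ioi x, -h' y ≤ 0 := fun y hy => neg_nonpos.2 (hp y hy)
  have hint : IntegrableOn h' (Ioi x) := by
    simpa using (integrableOn_Ioi_deriv_of_nonpos' hd hneg hL).neg
  have hval := integral_Ioi_of_hasDerivAt_of_nonpos' hd hneg hL
  rw [integral_neg] at hval
  rw [← ofReal_integral_eq_lintegral_ofReal hint
    ((ae_restrict_iff' measurableSet_Ioi).2 (Eventually.of_forall hp))]
  congr 1
  linarith

theorem lintegral_Ioi_mul_lintegral_Ioi {p w : ℝ → ℝ≥0∞} (hp : Measurable p) (hw : Measurable w)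
    (x : ℝ) :
    ∫⁻ y in Ioi x, p y * ∫⁻ z in Ioi y, w z = ∫⁻ z in Ioi x, w z * ∫⁻ y in Ioo x z, p y := by
  have hm : Measurable fun q : ℝ × ℝ =>
      {q : ℝ × ℝ | x < q.1 ∧ q.1 < q.2}.indicator (fun q => p q.1 * w q.2) q := by
    refine Measurable.indicator (by fun_prop) ?_
    exact (measurableSet_lt measurable_const measurable_fst).inter
      (measurableSet_lt measurable_fst measurable_snd)
  have hleft : ∫⁻ y in Ioi x, p y * ∫⁻ z in Ioi y, w z =
      ∫⁻ y, ∫⁻ z, {q : ℝ × ℝ | x < q.1 ∧ q.1 < q.2}.indicator (fun q => p q.1 * w q.2) (y, z) := by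
    rw [← lintegral_indicator measurableSet_Ioi]
    refine lintegral_congr fun y => ?_
    by_cases hy : x < y
    · rw [indicator_of_mem (by exact hy), ← lintegral_const_mul _ hw,
        ← lintegral_indicator measurableSet_Ioi]
      refine lintegral_congr fun z => ?_
      simp [indicator, hy]
    · rw [indicator_of_notMem (by exact hy)]
      simp [indicator, hy]
  have hright : ∫⁻ z in Ioi x, w z * ∫⁻ y in Ioo x z, p y =
      ∫⁻ z, ∫⁻ y, {q : ℝ × ℝ | x < q.1 ∧ q.1 < q.2}.indicator (fun q => p q.1 * w q.2) (y, z) := by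
    rw [← lintegral_indicator measurableSet_Ioi]
    refine lintegral_congr fun z => ?_
    by_cases hz : x < z
    · rw [indicator_of_mem (by exact hz), ← lintegral_const_mul _ hp,
        ← lintegral_indicator measurableSet_Ioo]
      refine lintegral_congr fun y => ?_
      simp [indicator, mul_comm]
    · rw [indicator_of_notMem (by exact hz)]
      have : ∀ y, ¬ (x < y ∧ y < z) := fun y h => hz (h.1.trans h.2)
      simp [indicator, this]
  rw [hleft, hright]
  exact lintegral_lintegral_swap (f := fun y z => {q : ℝ × ℝ | x < q.1 ∧ q.1 < q.2}.indicator
    (fun q => p q.1 * w q.2) (y, z)) hm.aemeasurable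

theorem lintegral_Ioo_sub_pow_div_factorial (m : ℕ) {x z : ℝ} (hxz : x < z) :
    ∫⁻ y in Ioo x z, ENNReal.ofReal ((y - x) ^ m / m.factorial) =
      ENNReal.ofReal ((z - x) ^ (m + 1) / (m + 1).factorial) := by
  have hint : IntervalIntegrable (fun y => (y - x) ^ m / (m.factorial : ℝ)) volume x z :=
    (by fun_prop : Continuous fun y => (y - x) ^ m / (m.factorial : ℝ)).intervalIntegrable _ _
  rw [← ofReal_integral_eq_lintegral_ofReal (hint.1.mono_set Ioo_subset_Ioc_self)
    ((ae_restrict_iff' measurableSet_Ioo).2 (Eventually.of_forall fun y hy => by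
      have := sub_pos.2 hy.1
      positivity)), ← integral_Ioc_eq_integral_Ioo, ← intervalIntegral.integral_of_le hxz.le]
  congr 1
  rw [intervalIntegral.integral_div, intervalIntegral.integral_comp_sub_right (fun y => y ^ m),
    integral_pow, Nat.factorial_succ]
  push_cast
  field_simp
  simp

namespace AlternatingDerivs

variable {g : ℕ → ℝ → ℝ}

theorem continuousOn (hg : AlternatingDerivs g) (n : ℕ) : ContinuousOn (g n) (Ioi 0) :=
  fun x hx => (hg.hasDerivAt n x hx).continuousAt.continuousWithinAt

theorem measurable_indicator (hg : AlternatingDerivs g) (n : ℕ) :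
    Measurable ((Ioi (0 : ℝ)).indicator (g n)) := by
  classical
  rw [← piecewise_eq_indicator]
  exact (hg.continuousOn n).measurable_piecewise continuousOn_const measurableSet_Ioi

theorem antitoneOn (hg : AlternatingDerivs g) (n : ℕ) : AntitoneOn (g n) (Ioi 0) := by
  refine antitoneOn_of_deriv_nonpos (convex_Ioi 0) (hg.continuousOn n) ?_ ?_
  · rw [interior_Ioi]
    exact fun x hx => (hg.hasDerivAt n x hx).differentiableAt.differentiableWithinAt
  · rw [interior_Ioi]
    intro x hx
    rw [(hg.hasDerivAt n x hx).deriv]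
    exact neg_nonpos.2 (hg.nonneg _ x hx)

theorem exists_tendsto (hg : AlternatingDerivs g) (n : ℕ) :
    ∃ L, 0 ≤ L ∧ Tendsto (g n) atTop (𝓝 L) := by
  have hpos : ∀ x : ℝ, max 1 x ∈ Ioi (0 : ℝ) := fun x => mem_Ioi.2 (lt_max_of_lt_left one_pos)
  have hanti : Antitone fun x => g n (max 1 x) := fun x y hxy =>
    hg.antitoneOn n (hpos x) (hpos y) (max_le_max le_rfl hxy)
  have hnonneg : ∀ x, 0 ≤ g n (max 1 x) := fun x => hg.nonneg n _ (hpos x)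
  have ht := tendsto_atTop_ciInf hanti ⟨0, by rintro _ ⟨x, rfl⟩; exact hnonneg x⟩
  refine ⟨_, le_ciInf hnonneg, ht.congr' ?_⟩
  filter_upwards [eventually_ge_atTop 1] with x hx
  rw [max_eq_right hx]

theorem tendsto_succ (hg : AlternatingDerivs g) (n : ℕ) : Tendsto (g (n + 1)) atTop (𝓝 0) := by
  obtain ⟨L, -, hL⟩ := hg.exists_tendsto n
  have hdiff : Tendsto (fun x => g n (x - 1) - g n x) atTop (𝓝 0) := by
    simpa [sub_eq_add_neg] using (hL.comp (tendsto_atTop_add_const_right _ (-1) tendsto_id)).sub hL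
  refine tendsto_of_tendsto_of_tendsto_of_le_of_le' tendsto_const_nhds hdiff ?_ ?_
  · filter_upwards [eventually_gt_atTop 0] with x hx using hg.nonneg _ x hx
  · filter_upwards [eventually_gt_atTop 1] with x hx
    have hpos : ∀ y ∈ Icc (x - 1) x, 0 < y := fun y hy => by linarith [hy.1]
    obtain ⟨c, hc, hc'⟩ := exists_hasDerivAt_eq_slope (g n) (fun y => -g (n + 1) y)
      (by linarith : x - 1 < x)
      ((hg.continuousOn n).mono hpos) fun y hy => hg.hasDerivAt n y (hpos y (Ioo_subset_Icc_self hy))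
    have := hg.antitoneOn (n + 1) (hpos c (Ioo_subset_Icc_self hc)) (by exact one_pos.trans hx) hc.2.le
    simp only [sub_sub_cancel, div_one] at hc'
    linarith

/-- Taylor's formula at infinity with integral remainder. -/
theorem lintegral_taylor (hg : AlternatingDerivs g) {L : ℝ} (hL : Tendsto (g 0) atTop (𝓝 L))
    (m : ℕ) {x : ℝ} (hx : 0 < x) :
    ∫⁻ y in Ioi x, ENNReal.ofReal (g (m + 1) y) * ENNReal.ofReal ((y - x) ^ m / m.factorial) =
      ENNReal.ofReal (g 0 x - L) := by
  induction m with
  | zero =>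
    simp only [pow_zero, Nat.factorial_zero, Nat.cast_one, div_one, ENNReal.ofReal_one, mul_one]
    exact lintegral_Ioi_of_hasDerivAt_neg (fun y hy => hg.hasDerivAt 0 y (hx.trans_le hy))
      (fun y hy => hg.nonneg _ y (hx.trans hy)) hL
  | succ m ih =>
    rw [← ih]
    set w : ℝ → ℝ≥0∞ := fun z => ENNReal.ofReal ((Ioi (0 : ℝ)).indicator (g (m + 2)) z) with hw_def
    have hw : Measurable w := (hg.measurable_indicator _).ennreal_ofReal
    have hwz : ∀ z, 0 < z → w z = ENNReal.ofReal (g (m + 2) z) := fun z hz => by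
      rw [hw_def]
      simp only
      rw [indicator_of_mem (by exact hz)]
    have hp : Measurable fun y : ℝ => ENNReal.ofReal ((y - x) ^ m / m.factorial) := by fun_prop
    have h1 : ∀ y ∈ Ioi x, ENNReal.ofReal (g (m + 1) y) *
        ENNReal.ofReal ((y - x) ^ m / m.factorial) =
        ENNReal.ofReal ((y - x) ^ m / m.factorial) * ∫⁻ z in Ioi y, w z := fun y hy => by
      have hy0 : 0 < y := hx.trans hy
      rw [mul_comm, setLIntegral_congr_fun measurableSet_Ioi fun z hz => hwz z (hy0.trans hz),
        lintegral_Ioi_of_hasDerivAt_neg (fun z hz => hg.hasDerivAt (m + 1) z (hy0.trans_le hz))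
          (fun z hz => hg.nonneg _ z (hy0.trans hz)) (hg.tendsto_succ m), sub_zero]
    rw [setLIntegral_congr_fun measurableSet_Ioi h1, lintegral_Ioi_mul_lintegral_Ioi hp hw]
    refine setLIntegral_congr_fun measurableSet_Ioi fun z hz => ?_
    rw [lintegral_Ioo_sub_pow_div_factorial m hz, hwz z (hx.trans hz)]

end AlternatingDerivs

/-- A version of Bernstein's theorem in which the kernel `exp (-s * t)` is replaced by
the truncated power `(1 - s * t)₊ ^ m`. -/
theorem AlternatingDerivs.exists_truncated_bernstein {g : ℕ → ℝ → ℝ} (hg : AlternatingDerivs g)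
    {m : ℕ} (hm : m ≠ 0) :
    ∃ ν : Measure ℝ≥0, SFinite ν ∧ ∀ s, 0 < s →
      ENNReal.ofReal (g 0 s) = ∫⁻ τ, ENNReal.ofReal (max 0 (1 - s * τ) ^ m) ∂ν := by
  obtain ⟨L, hL0, hL⟩ := hg.exists_tendsto 0
  set w : ℝ → ℝ≥0∞ := fun r => ENNReal.ofReal ((Ioi (0 : ℝ)).indicator (g (m + 1)) r) *
    ENNReal.ofReal (r ^ m / m.factorial) with hw_def
  have hw : Measurable w := (hg.measurable_indicator _).ennreal_ofReal.mul (by fun_prop)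
  have hφ : Measurable fun r : ℝ => (r⁻¹).toNNReal := by fun_prop
  refine ⟨ENNReal.ofReal L • Measure.dirac 0 +
    ((volume.restrict (Ioi 0)).withDensity w).map (fun r : ℝ => (r⁻¹).toNNReal),
    inferInstance, fun s hs => ?_⟩
  have hk : Measurable fun τ : ℝ≥0 => ENNReal.ofReal (max 0 (1 - s * (τ : ℝ)) ^ m) := by fun_prop
  rw [lintegral_add_measure, lintegral_smul_measure, lintegral_dirac' _ hk,
    lintegral_map hk hφ, lintegral_withDensity_eq_lintegral_mul _ hw
      (g := fun r => ENNReal.ofReal (max 0 (1 - s * ((r⁻¹).toNNReal : ℝ)) ^ m)) (hk.comp hφ)]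
  have hLs : L ≤ g 0 s := le_of_tendsto hL <| by
    filter_upwards [eventually_ge_atTop s] with y hy using
      hg.antitoneOn 0 hs (hs.trans_le hy) hy
  have hsplit : ENNReal.ofReal (g 0 s) = ENNReal.ofReal L + ENNReal.ofReal (g 0 s - L) := by
    rw [← ENNReal.ofReal_add hL0 (sub_nonneg.2 hLs)]
    congr 1
    ring
  rw [hsplit, ← hg.lintegral_taylor hL m hs]
  congr 1
  · simp
  · rw [← lintegral_indicator measurableSet_Ioi, ← lintegral_indicator measurableSet_Ioi]
    refine lintegral_congr fun y => ?_
    by_cases hy0 : 0 < y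
    · rw [indicator_of_mem (s := Ioi 0) (show y ∈ Ioi (0 : ℝ) from hy0)]
      simp only [Pi.mul_apply, hw_def, indicator_of_mem (show y ∈ Ioi (0 : ℝ) from hy0)]
      rw [Real.coe_toNNReal _ (inv_nonneg.2 hy0.le)]
      by_cases hy : s < y
      · have h1 : 0 ≤ 1 - s * y⁻¹ := by
          rw [← div_eq_mul_inv, sub_nonneg, div_le_one hy0]
          exact hy.le
        have h2 : y * (1 - s * y⁻¹) = y - s := by field_simp
        rw [indicator_of_mem (by exact hy), mul_assoc,
          ← ENNReal.ofReal_mul (by positivity : 0 ≤ y ^ m / (m.factorial : ℝ)), max_eq_right h1,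
          div_mul_eq_mul_div, ← mul_pow, h2]
      · have h1 : 1 - s * y⁻¹ ≤ 0 := by
          rw [← div_eq_mul_inv, sub_nonpos, one_le_div hy0]
          exact not_lt.1 hy
        rw [indicator_of_notMem (by exact hy), max_eq_left h1, zero_pow hm]
        simp
    · rw [indicator_of_notMem (show y ∉ Ioi (0 : ℝ) from hy0),
        indicator_of_notMem (show y ∉ Ioi s from fun h => hy0 (hs.trans h))]

theorem max_one_sub_pow_le_exp {v : ℝ} (m : ℕ) : max 0 (1 - v) ^ m ≤ exp (-(m * v)) := by
  rw [show -(m * v) = m * (-v) by ring, Real.exp_nat_mul]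
  exact pow_le_pow_left₀ (le_max_left _ _)
    (max_le (Real.exp_pos _).le (Real.one_sub_le_exp_neg v)) m

theorem exp_mul_le_max_one_sub_pow {v : ℝ} (hv : 0 ≤ v) {m : ℕ} (hm : m ≠ 0) :
    exp (-(m * v)) * (1 - m * v ^ 2) ≤ max 0 (1 - v) ^ m := by
  have hm1 : (1 : ℝ) ≤ m := by exact_mod_cast Nat.one_le_iff_ne_zero.2 hm
  rcases le_total v 1 with h | h
  · rw [max_eq_right (by linarith)]
    have hb : 1 + (m : ℝ) * (-v ^ 2) ≤ (1 + -v ^ 2) ^ m := one_add_mul_le_pow (by nlinarith) m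
    have he : (1 - v ^ 2) ≤ (1 - v) * exp v := by
      nlinarith [Real.add_one_le_exp v]
    have hp : (1 - v ^ 2) ^ m ≤ ((1 - v) * exp v) ^ m := pow_le_pow_left₀ (by nlinarith) he m
    rw [mul_neg, ← sub_eq_add_neg, ← sub_eq_add_neg] at hb
    have hm2 : 1 - m * v ^ 2 ≤ ((1 - v) * exp v) ^ m := hb.trans hp
    calc exp (-(m * v)) * (1 - m * v ^ 2)
        ≤ exp (-(m * v)) * ((1 - v) * exp v) ^ m := by gcongr
      _ = (1 - v) ^ m := by
        rw [mul_pow, ← Real.exp_nat_mul, mul_left_comm, ← Real.exp_add]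
        simp
  · have h1 : 1 - m * v ^ 2 ≤ 0 := by nlinarith
    exact (mul_nonpos_of_nonneg_of_nonpos (Real.exp_pos _).le h1).trans
      (pow_nonneg (le_max_left _ _) m)

theorem exp_mul_le_max_one_sub_pow_mul {v w : ℝ} (hv : 0 ≤ v) (hw : 0 ≤ w) {m : ℕ} (hm : m ≠ 0) :
    exp (-(m * (v + w))) * (1 - m * (v + w) ^ 2) ≤ max 0 (1 - v) ^ m * max 0 (1 - w) ^ m := by
  have hA := exp_mul_le_max_one_sub_pow hv hm
  have hB := exp_mul_le_max_one_sub_pow hw hm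
  have hpos : 0 ≤ max 0 (1 - v) ^ m * max 0 (1 - w) ^ m := by positivity
  have hvw : m * (v ^ 2 + w ^ 2) ≤ m * (v + w) ^ 2 := by
    gcongr
    nlinarith [mul_nonneg hv hw]
  have hmv : 0 ≤ m * v ^ 2 := by positivity
  have hmw : 0 ≤ m * w ^ 2 := by positivity
  by_cases h : m * (v + w) ^ 2 ≤ 1
  · have h1 : 0 ≤ 1 - m * v ^ 2 := by nlinarith
    have h2 : 0 ≤ 1 - m * w ^ 2 := by nlinarith
    refine le_trans ?_ (mul_le_mul hA hB (mul_nonneg (Real.exp_pos _).le h2) (by positivity))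
    rw [show -(m * (v + w)) = -(m * v) + -(m * w) by ring, Real.exp_add,
      show exp (-(m * v)) * (1 - m * v ^ 2) * (exp (-(m * w)) * (1 - m * w ^ 2)) =
        exp (-(m * v)) * exp (-(m * w)) * ((1 - m * v ^ 2) * (1 - m * w ^ 2)) by ring]
    gcongr
    nlinarith [mul_nonneg hmv hmw]
  · exact (mul_nonpos_of_nonneg_of_nonpos (Real.exp_pos _).le (by linarith)).trans hpos

theorem lintegral_rpow_mul_exp_neg_mul_Ioi {a r : ℝ} (ha : 0 < a) (hr : 0 < r) :
    ∫⁻ t in Ioi 0, ENNReal.ofReal (t ^ (a - 1) * exp (-(r * t))) =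
      ENNReal.ofReal ((1 / r) ^ a * Gamma a) := by
  have hval := integral_rpow_mul_exp_neg_mul_Ioi ha hr
  have hpos : 0 < (1 / r) ^ a * Gamma a := mul_pos (by positivity) (Gamma_pos_of_pos ha)
  rw [← hval, ofReal_integral_eq_lintegral_ofReal]
  · by_contra h
    rw [integral_undef h] at hval
    exact hpos.ne hval
  · refine (ae_restrict_iff' measurableSet_Ioi).2 (Eventually.of_forall fun t ht => ?_)
    have ht' : 0 < t := ht
    simp only [Pi.zero_apply]
    positivity

/-- The kernel obtained by truncating the Laplace integral of `(x + τ) ^ (-lam)`. -/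
noncomputable def truncatedKernel (lam : ℝ) (m : ℕ) (x τ : ℝ) : ℝ≥0∞ :=
  ∫⁻ s in Ioi 0, ENNReal.ofReal (s ^ (lam - 1) * max 0 (1 - x * s) ^ m) *
    ENNReal.ofReal (max 0 (1 - s * τ) ^ m)

theorem truncatedKernel_le {lam : ℝ} (hlam : 0 < lam) {m : ℕ} (hm : m ≠ 0) {x τ : ℝ} (hx : 0 < x)
    (hτ : 0 ≤ τ) :
    truncatedKernel lam m x τ ≤ ENNReal.ofReal ((1 / (m * (x + τ))) ^ lam * Gamma lam) := by
  have hm0 : (0 : ℝ) < m := by exact_mod_cast Nat.pos_of_ne_zero hm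
  rw [← lintegral_rpow_mul_exp_neg_mul_Ioi hlam (by positivity : 0 < m * (x + τ))]
  refine setLIntegral_mono' measurableSet_Ioi fun s hs => ?_
  have hs' : 0 < s := hs
  rw [← ENNReal.ofReal_mul (by positivity)]
  apply ENNReal.ofReal_le_ofReal
  rw [mul_assoc, show -(m * (x + τ) * s) = -(m * (x * s)) + -(m * (s * τ)) by ring, Real.exp_add]
  gcongr
  · exact max_one_sub_pow_le_exp m
  · exact max_one_sub_pow_le_exp m

theorem le_truncatedKernel {lam : ℝ} (hlam : 0 < lam) {m : ℕ} (hm : m ≠ 0) {x τ : ℝ} (hx : 0 < x)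
    (hτ : 0 ≤ τ) :
    (1 - ENNReal.ofReal (lam * (lam + 1) / m)) *
      ENNReal.ofReal ((1 / (m * (x + τ))) ^ lam * Gamma lam) ≤ truncatedKernel lam m x τ := by
  have hm0 : (0 : ℝ) < m := by exact_mod_cast Nat.pos_of_ne_zero hm
  set R : ℝ := m * (x + τ) with hR
  have hR0 : 0 < R := by positivity
  rw [ENNReal.sub_mul fun _ _ => ENNReal.ofReal_ne_top, one_mul, tsub_le_iff_right,
    ← ENNReal.ofReal_mul (by positivity)]
  have hG : (1 / R) ^ lam * Gamma lam * (lam * (lam + 1) / m) =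
      R ^ 2 / m * ((1 / R) ^ (lam + 2) * Gamma (lam + 2)) := by
    rw [show lam + 2 = lam + 1 + 1 by ring, Gamma_add_one (by positivity),
      Gamma_add_one hlam.ne', show lam + 1 + 1 = lam + (2 : ℕ) by push_cast; ring,
      Real.rpow_add_natCast (by positivity)]
    field_simp
  rw [mul_comm (lam * (lam + 1) / m), hG, ENNReal.ofReal_mul (by positivity : 0 ≤ R ^ 2 / m),
    ← lintegral_rpow_mul_exp_neg_mul_Ioi hlam hR0,
    ← lintegral_rpow_mul_exp_neg_mul_Ioi (by positivity : 0 < lam + 2) hR0,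
    ← lintegral_const_mul _ (by fun_prop), truncatedKernel, ← lintegral_add_right _ (by fun_prop)]
  refine setLIntegral_mono' measurableSet_Ioi fun s hs => ?_
  have hs' : 0 < s := hs
  rw [← ENNReal.ofReal_mul (by positivity), ← ENNReal.ofReal_mul (by positivity),
    ← ENNReal.ofReal_add (by positivity) (by positivity)]
  apply ENNReal.ofReal_le_ofReal
  have hk := exp_mul_le_max_one_sub_pow_mul (v := x * s) (w := s * τ) (by positivity)
    (by positivity) hm
  have hpow : s ^ (lam + 2 - 1) = s ^ (lam - 1) * s ^ 2 := by
    rw [show lam + 2 - 1 = lam - 1 + (2 : ℕ) by push_cast; ring, Real.rpow_add_natCast hs'.ne']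
  rw [show m * (x * s + s * τ) = R * s by rw [hR]; ring,
    show m * (x * s + s * τ) ^ 2 = R ^ 2 / m * s ^ 2 by rw [hR]; field_simp] at hk
  have := mul_le_mul_of_nonneg_left hk (Real.rpow_nonneg hs'.le (lam - 1))
  rw [hpow]
  nlinarith

/-- The functions `A n k` are the alternating derivatives of the functions `c_k` attached
to `A 0 0`. -/
structure StieltjesFamily (lam : ℝ) (A : ℕ → ℕ → ℝ → ℝ) : Prop where
  hasDerivAt : ∀ n k x, 0 < x → HasDerivAt (A n k) (-A (n + 1) k x) x
  nonneg : ∀ n k x, 0 < x → 0 ≤ A n k x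
  succ_right : ∀ n k x, 0 < x → A n (k + 1) x = (lam + n + k) * A n k x - x * A (n + 1) k x

namespace StieltjesFamily

variable {lam : ℝ} {A : ℕ → ℕ → ℝ → ℝ}

theorem alternatingDerivs (hA : StieltjesFamily lam A) (k : ℕ) :
    AlternatingDerivs fun n => A n k :=
  ⟨fun n => hA.hasDerivAt n k, fun n => hA.nonneg n k⟩

theorem alternatingDerivs_inv (hA : StieltjesFamily lam A) (n : ℕ) :
    AlternatingDerivs fun k s => s ^ (-lam - n - k) * A n k s⁻¹ := by
  refine ⟨fun k s hs => ?_, fun k s hs => ?_⟩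
  · have h1 := Real.hasDerivAt_rpow_const (x := s) (p := -lam - n - k) (Or.inl hs.ne')
    have h2 := (hA.hasDerivAt n k s⁻¹ (inv_pos.2 hs)).comp s (hasDerivAt_inv hs.ne')
    refine (h1.mul h2).congr_deriv ?_
    rw [hA.succ_right n k _ (inv_pos.2 hs), Nat.cast_succ,
      show -lam - n - (k + 1 : ℝ) = -lam - n - k - 1 by ring, Real.rpow_sub_one hs.ne']
    simp only [Function.comp]
    field_simp
    ring
  · exact mul_nonneg (Real.rpow_nonneg hs.le _) (hA.nonneg n k _ (inv_pos.2 hs))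

theorem exists_lintegral_truncatedKernel (hA : StieltjesFamily lam A) {L : ℝ}
    (hL : Tendsto (A 0 0) atTop (𝓝 L)) {m : ℕ} (hm : m ≠ 0) :
    ∃ ν : Measure ℝ≥0, ∀ x, 0 < x →
      ENNReal.ofReal (A 0 0 x - L) = ∫⁻ τ, truncatedKernel lam m x τ ∂ν := by
  obtain ⟨ν, hν, hνs⟩ := (hA.alternatingDerivs_inv (m + 1)).exists_truncated_bernstein hm
  refine ⟨ENNReal.ofReal (1 / m.factorial) • ν, fun x hx => ?_⟩
  have hmeas : Measurable fun p : ℝ × ℝ≥0 =>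
      ENNReal.ofReal (p.1 ^ (lam - 1) * max 0 (1 - x * p.1) ^ m) *
        ENNReal.ofReal (max 0 (1 - p.1 * p.2) ^ m) := by fun_prop
  have hswap := lintegral_lintegral_swap (μ := volume.restrict (Ioi (0 : ℝ))) (ν := ν)
    (f := fun s τ => ENNReal.ofReal (s ^ (lam - 1) * max 0 (1 - x * s) ^ m) *
        ENNReal.ofReal (max 0 (1 - s * (τ : ℝ)) ^ m)) hmeas.aemeasurable
  simp only [truncatedKernel]
  rw [lintegral_smul_measure, ← hswap, smul_eq_mul,
    ← (hA.alternatingDerivs 0).lintegral_taylor hL m hx, ← lintegral_const_mul _ (by fun_prop)]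
  have himage : (fun s : ℝ => s⁻¹) '' Ioo 0 x⁻¹ = Ioi x := by
    rw [Set.image_inv_eq_inv, Set.inv_Ioo_0_left (inv_pos.2 hx), inv_inv]
  rw [← himage, lintegral_image_eq_lintegral_abs_deriv_mul measurableSet_Ioo
    (fun s hs => (hasDerivAt_inv hs.1.ne').hasDerivWithinAt) inv_injective.injOn,
    ← lintegral_indicator measurableSet_Ioo, ← lintegral_indicator measurableSet_Ioi]
  refine lintegral_congr fun s => ?_
  by_cases hs : 0 < s
  · rw [indicator_of_mem (show s ∈ Ioi (0 : ℝ) from hs), lintegral_const_mul _ (by fun_prop),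
      ← hνs s hs]
    by_cases hsx : s < x⁻¹
    · have h1 : 0 ≤ 1 - x * s := by
        rw [lt_inv_comm₀ hs hx, ← one_div, lt_div_iff₀ hs] at hsx
        linarith
      have h2 : 0 ≤ s⁻¹ - x := by
        rw [lt_inv_comm₀ hs hx] at hsx
        linarith
      have h3 := hA.nonneg (m + 1) 0 s⁻¹ (inv_pos.2 hs)
      rw [indicator_of_mem (show s ∈ Ioo 0 x⁻¹ from ⟨hs, hsx⟩), max_eq_right h1,
        ← ENNReal.ofReal_mul h3, ← ENNReal.ofReal_mul (abs_nonneg _),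
        ← ENNReal.ofReal_mul (by positivity), ← ENNReal.ofReal_mul (by positivity)]
      congr 1
      have hpow : s ^ (lam - 1) * s ^ (-lam - ((m + 1 : ℕ) : ℝ) - ((0 : ℕ) : ℝ)) =
          (s ^ 2)⁻¹ * (s ^ m)⁻¹ := by
        rw [← Real.rpow_add hs, ← mul_inv, ← pow_add, ← Real.rpow_natCast, ← Real.rpow_neg hs.le]
        congr 1
        push_cast
        ring
      rw [abs_neg, abs_of_nonneg (by positivity),
        show s⁻¹ - x = (1 - x * s) * s⁻¹ by field_simp, mul_pow, inv_pow]
      linear_combination (-(1 / m.factorial) * (1 - x * s) ^ m * A (m + 1) 0 s⁻¹) * hpow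
    · have h1 : 1 - x * s ≤ 0 := by
        rw [not_lt, inv_le_comm₀ hx hs, inv_le_iff_one_le_mul₀ hs] at hsx
        linarith
      rw [indicator_of_notMem (fun h => hsx h.2), max_eq_left h1, zero_pow hm]
      simp
  · rw [indicator_of_notMem (fun h => hs h.1), indicator_of_notMem (by exact hs)]

end StieltjesFamily

theorem exists_finiteMeasure_of_tendsto_lintegral {X ι : Type*} [TopologicalSpace X] [T2Space X]
    [CompactSpace X] [MeasurableSpace X] [BorelSpace X] {σ : ℕ → Measure X} {C : ℝ≥0}
    (hσ : ∀ᶠ n in atTop, σ n univ ≤ C) {k : ι → C(X, ℝ)} (hk : ∀ i w, 0 ≤ k i w) {l : ι → ℝ}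
    (hl : ∀ i, 0 ≤ l i)
    (ht : ∀ i, Tendsto (fun n => ∫⁻ w, ENNReal.ofReal (k i w) ∂σ n) atTop
      (𝓝 (ENNReal.ofReal (l i)))) :
    ∃ ρ : FiniteMeasure X, ∀ i, ∫⁻ w, ENNReal.ofReal (k i w) ∂(ρ : Measure X) =
      ENNReal.ofReal (l i) := by
  obtain ⟨M, hM⟩ := eventually_atTop.1 hσ
  let s : ℕ → FiniteMeasure X := fun n =>
    ⟨σ (n + M), ⟨(hM (n + M) (Nat.le_add_left _ _)).trans_lt ENNReal.coe_lt_top⟩⟩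
  have hs : ∀ n, (s n).mass ≤ C := fun n => by
    rw [← ENNReal.coe_le_coe, FiniteMeasure.ennreal_mass]
    exact hM (n + M) (Nat.le_add_left _ _)
  have hU : ((hyperfilter ℕ : Ultrafilter ℕ) : Filter ℕ) ≤ atTop := Nat.hyperfilter_le_atTop
  obtain ⟨ρ, -, hρ⟩ := (isCompact_setOfPred_finiteMeasure_le_of_compactSpace X C).ultrafilter_le_nhds'
    ((hyperfilter ℕ).map s) (Ultrafilter.mem_map.2 (Filter.univ_mem' hs))
  have hρ' : Tendsto s (hyperfilter ℕ) (𝓝 ρ) := hρ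
  have hint : ∀ (μ : FiniteMeasure X) i, ∫ w, k i w ∂(μ : Measure X) =
      (∫⁻ w, ENNReal.ofReal (k i w) ∂(μ : Measure X)).toReal := fun μ i =>
    integral_eq_lintegral_of_nonneg_ae (Eventually.of_forall (hk i))
      (k i).continuous.aestronglyMeasurable
  refine ⟨ρ, fun i => ?_⟩
  have h1 : Tendsto (fun n => ∫ w, k i w ∂(s n : Measure X)) (hyperfilter ℕ)
      (𝓝 (∫ w, k i w ∂(ρ : Measure X))) :=
    ((FiniteMeasure.continuous_integral_continuousMap (k i)).tendsto ρ).comp hρ'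
  have h2 : Tendsto (fun n => ∫ w, k i w ∂(s n : Measure X)) (hyperfilter ℕ) (𝓝 (l i)) := by
    have h3 := ((ENNReal.tendsto_toReal ENNReal.ofReal_ne_top).comp
      ((ht i).comp (tendsto_add_atTop_nat M))).mono_left hU
    rw [ENNReal.toReal_ofReal (hl i)] at h3
    exact h3.congr fun n => (hint (s n) i).symm
  rw [← tendsto_nhds_unique h1 h2, ofReal_integral_eq_lintegral_ofReal
    ((k i).continuous.integrable_of_hasCompactSupport (HasCompactSupport.of_compactSpace _))
    (Eventually.of_forall (hk i))]

theorem one_add_sub_one_mul_pos {x : ℝ} (hx : 0 < x) (w : unitInterval) :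
    0 < 1 + (x - 1) * (w : ℝ) := by
  rcases w.2.1.eq_or_lt with h | h
  · simp [← h]
  · nlinarith [w.2.2, mul_pos hx h]

/-- The function `w ↦ (1 + (x - 1) * w) ^ (-lam)`, which is `(x + t) ^ (-lam)` in the coordinate
`w = 1 / (1 + t)`, up to the factor `(1 + t) ^ (-lam)`. -/
noncomputable def compactKernel (lam : ℝ) (x : Ioi (0 : ℝ)) : C(unitInterval, ℝ) where
  toFun w := (1 + ((x : ℝ) - 1) * (w : ℝ)) ^ (-lam)
  continuous_toFun := Continuous.rpow_const (by fun_prop)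
    fun w => Or.inl (one_add_sub_one_mul_pos x.2 w).ne'

theorem exists_stieltjes_of_lintegral_compactKernel {lam : ℝ} (ρ : FiniteMeasure unitInterval)
    {g : ℝ → ℝ} (hg : ∀ x, 0 < x → 0 ≤ g x)
    (hρ : ∀ x : Ioi (0 : ℝ), ∫⁻ w, ENNReal.ofReal (compactKernel lam x w) ∂(ρ : Measure unitInterval)
      = ENNReal.ofReal (g x)) :
    ∃ c : ℝ, 0 ≤ c ∧ ∃ μ : Measure ℝ,
      (∀ x : ℝ, 0 < x → IntegrableOn (fun t => (x + t) ^ (-lam)) (Ici 0) μ) ∧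
      (∀ x : ℝ, 0 < x → g x = c + ∫ t in Ici 0, (x + t) ^ (-lam) ∂μ) := by
  set σ : Measure unitInterval := ρ.toMeasure
  have hφ : Measurable fun w : unitInterval => (1 - (w : ℝ)) / (w : ℝ) := by fun_prop
  have hd : Measurable fun w : unitInterval => ENNReal.ofReal ((w : ℝ) ^ (-lam)) := by fun_prop
  set μ : Measure ℝ := (((σ.restrict {0}ᶜ).withDensity fun w => ENNReal.ofReal ((w : ℝ) ^ (-lam))).map
    fun w : unitInterval => (1 - (w : ℝ)) / (w : ℝ)) with hμ
  have hpre : (fun w : unitInterval => (1 - (w : ℝ)) / (w : ℝ)) ⁻¹' Ici 0 = univ :=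
    eq_univ_of_forall fun w => div_nonneg (sub_nonneg.2 w.2.2) w.2.1
  have hμk : ∀ x : Ioi (0 : ℝ), ∫⁻ t in Ici 0, ENNReal.ofReal (((x : ℝ) + t) ^ (-lam)) ∂μ =
      ∫⁻ w in {0}ᶜ, ENNReal.ofReal (compactKernel lam x w) ∂σ := fun x => by
    have hm : Measurable fun t : ℝ => ENNReal.ofReal (((x : ℝ) + t) ^ (-lam)) := by fun_prop
    rw [hμ, setLIntegral_map measurableSet_Ici hm hφ, hpre, Measure.restrict_univ,
      lintegral_withDensity_eq_lintegral_mul _ hd (g := fun w : unitInterval =>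
        ENNReal.ofReal (((x : ℝ) + (1 - (w : ℝ)) / (w : ℝ)) ^ (-lam))) (hm.comp hφ)]
    refine setLIntegral_congr_fun (measurableSet_singleton _).compl fun w hw => ?_
    have hw0 : 0 < (w : ℝ) := unitInterval.pos_iff_ne_zero.2 hw
    have hb := one_add_sub_one_mul_pos x.2 w
    simp only [Pi.mul_apply]
    rw [← ENNReal.ofReal_mul (by positivity)]
    congr 1
    rw [show (x : ℝ) + (1 - w) / w = (1 + (x - 1) * w) / w by field_simp; ring,
      Real.div_rpow hb.le hw0.le, mul_div_cancel₀ _ (Real.rpow_pos_of_pos hw0 _).ne']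
    rfl
  have hsplit : ∀ x : Ioi (0 : ℝ), ENNReal.ofReal (g x) =
      σ {0} + ∫⁻ t in Ici 0, ENNReal.ofReal (((x : ℝ) + t) ^ (-lam)) ∂μ := fun x => by
    rw [hμk, ← hρ, ← lintegral_add_compl _ (measurableSet_singleton (0 : unitInterval)),
      lintegral_singleton]
    simp [compactKernel]
  have hfin : ∀ x : Ioi (0 : ℝ), ∫⁻ t in Ici 0, ENNReal.ofReal (((x : ℝ) + t) ^ (-lam)) ∂μ ≠ ∞ :=
    fun x => ne_top_of_le_ne_top ENNReal.ofReal_ne_top (le_add_self.trans (hsplit x).ge)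
  have hnonneg : ∀ x : Ioi (0 : ℝ), 0 ≤ᵐ[μ.restrict (Ici 0)] fun t => ((x : ℝ) + t) ^ (-lam) :=
    fun x => (ae_restrict_iff' measurableSet_Ici).2 <| Eventually.of_forall fun t ht =>
      Real.rpow_nonneg (add_nonneg (le_of_lt x.2) ht) _
  have hmeas : ∀ x : ℝ, AEStronglyMeasurable (fun t => (x + t) ^ (-lam)) (μ.restrict (Ici 0)) :=
    fun x => (by fun_prop : Measurable fun t : ℝ => (x + t) ^ (-lam)).aestronglyMeasurable
  refine ⟨(σ {0}).toReal, ENNReal.toReal_nonneg, μ, fun x hx => ?_, fun x hx => ?_⟩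
  · exact (lintegral_ofReal_ne_top_iff_integrable (hmeas x) (hnonneg ⟨x, hx⟩)).1 (hfin ⟨x, hx⟩)
  · rw [integral_eq_lintegral_of_nonneg_ae (hnonneg ⟨x, hx⟩) (hmeas x),
      ← ENNReal.toReal_add (measure_ne_top _ _) (hfin ⟨x, hx⟩), ← hsplit ⟨x, hx⟩,
      ENNReal.toReal_ofReal (hg x hx)]

/-- A pointwise limit of generalized Stieltjes functions is a generalized Stieltjes function. -/
theorem exists_stieltjes_of_tendsto {lam : ℝ} {ν : ℕ → Measure ℝ≥0} {g : ℝ → ℝ}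
    (hg : ∀ x, 0 < x → 0 ≤ g x)
    (ht : ∀ x, 0 < x → Tendsto (fun n => ∫⁻ τ, ENNReal.ofReal ((x + (τ : ℝ)) ^ (-lam)) ∂ν n) atTop
      (𝓝 (ENNReal.ofReal (g x)))) :
    ∃ c : ℝ, 0 ≤ c ∧ ∃ μ : Measure ℝ,
      (∀ x : ℝ, 0 < x → IntegrableOn (fun t => (x + t) ^ (-lam)) (Ici 0) μ) ∧
      (∀ x : ℝ, 0 < x → g x = c + ∫ t in Ici 0, (x + t) ^ (-lam) ∂μ) := by
  let φ : ℝ≥0 → unitInterval := fun τ =>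
    ⟨(1 + (τ : ℝ))⁻¹, by positivity, inv_le_one_of_one_le₀ (by simp)⟩
  have hφ : Measurable φ := Measurable.subtype_mk (by fun_prop)
  have hd : Measurable fun τ : ℝ≥0 => ENNReal.ofReal ((1 + (τ : ℝ)) ^ (-lam)) := by fun_prop
  let σ : ℕ → Measure unitInterval := fun n =>
    ((ν n).withDensity fun τ => ENNReal.ofReal ((1 + (τ : ℝ)) ^ (-lam))).map φ
  have hσ : ∀ n (x : Ioi (0 : ℝ)), ∫⁻ w, ENNReal.ofReal (compactKernel lam x w) ∂σ n =
      ∫⁻ τ, ENNReal.ofReal (((x : ℝ) + (τ : ℝ)) ^ (-lam)) ∂ν n := fun n x => by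
    have hm : Measurable fun w => ENNReal.ofReal (compactKernel lam x w) :=
      (compactKernel lam x).continuous.measurable.ennreal_ofReal
    rw [lintegral_map hm hφ, lintegral_withDensity_eq_lintegral_mul _ hd
      (g := fun τ => ENNReal.ofReal (compactKernel lam x (φ τ))) (hm.comp hφ)]
    refine lintegral_congr fun τ => ?_
    have hx : 0 < (x : ℝ) := x.2
    have h1 : 0 < 1 + (τ : ℝ) := by positivity
    have h2 : 0 < (x : ℝ) + (τ : ℝ) := by positivity
    simp only [Pi.mul_apply]
    rw [← ENNReal.ofReal_mul (by positivity)]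
    congr 1
    change (1 + (τ : ℝ)) ^ (-lam) * (1 + ((x : ℝ) - 1) * (1 + (τ : ℝ))⁻¹) ^ (-lam) = _
    rw [show 1 + ((x : ℝ) - 1) * (1 + (τ : ℝ))⁻¹ = (x + τ) / (1 + τ) by field_simp; ring,
      Real.div_rpow h2.le h1.le, mul_div_cancel₀ _ (Real.rpow_pos_of_pos h1 _).ne']
  have hmass : ∀ n, σ n univ = ∫⁻ τ, ENNReal.ofReal ((1 + (τ : ℝ)) ^ (-lam)) ∂ν n := fun n => by
    rw [Measure.map_apply hφ MeasurableSet.univ, preimage_univ, withDensity_apply _ MeasurableSet.univ,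
      Measure.restrict_univ]
  have hbound : ∀ᶠ n in atTop, σ n univ ≤ ((g 1).toNNReal + 1 : ℝ≥0) := by
    have hlt : ENNReal.ofReal (g 1) < ((g 1).toNNReal + 1 : ℝ≥0) :=
      ENNReal.coe_lt_coe.2 (lt_add_one _)
    filter_upwards [(ht 1 one_pos).eventually_lt_const hlt] with n hn
    rw [hmass]
    exact hn.le
  obtain ⟨ρ, hρ⟩ := exists_finiteMeasure_of_tendsto_lintegral hbound (k := compactKernel lam)
    (fun x w => Real.rpow_nonneg (one_add_sub_one_mul_pos x.2 w).le _) (l := fun x => g x)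
    (fun x => hg x x.2) fun x => (ht x x.2).congr fun n => (hσ n x).symm
  exact exists_stieltjes_of_lintegral_compactKernel ρ hg hρ

theorem StieltjesFamily.exists_stieltjes {lam : ℝ} (hlam : 0 < lam) {A : ℕ → ℕ → ℝ → ℝ}
    (hA : StieltjesFamily lam A) :
    ∃ c : ℝ, 0 ≤ c ∧ ∃ μ : Measure ℝ,
      (∀ x : ℝ, 0 < x → IntegrableOn (fun t => (x + t) ^ (-lam)) (Ici 0) μ) ∧
      (∀ x : ℝ, 0 < x → A 0 0 x = c + ∫ t in Ici 0, (x + t) ^ (-lam) ∂μ) := by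
  obtain ⟨L, hL0, hL⟩ := (hA.alternatingDerivs 0).exists_tendsto 0
  have hLle : ∀ x, 0 < x → 0 ≤ A 0 0 x - L := fun x hx => sub_nonneg.2 <| le_of_tendsto hL <| by
    filter_upwards [eventually_ge_atTop x] with y hy using
      (hA.alternatingDerivs 0).antitoneOn 0 hx (hx.trans_le hy) hy
  choose ν hν using fun m : ℕ => hA.exists_lintegral_truncatedKernel hL (m.succ_ne_zero)
  let δ : ℕ → ℝ≥0∞ := fun m => ENNReal.ofReal (lam * (lam + 1) / (m + 1 : ℕ))
  have hδ0 : Tendsto (fun m => 1 - δ m) atTop (𝓝 1) := by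
    have h1 : Tendsto δ atTop (𝓝 0) := by
      have h2 := (tendsto_const_div_atTop_nhds_zero_nat (lam * (lam + 1))).comp
        (tendsto_add_atTop_nat 1)
      rw [← ENNReal.ofReal_zero]
      exact ENNReal.tendsto_ofReal h2
    simpa using ENNReal.Tendsto.sub tendsto_const_nhds h1 (Or.inl ENNReal.one_ne_top)
  have hkernel : ∀ (m : ℕ) {x : ℝ}, 0 < x → ∀ τ : ℝ≥0,
      ENNReal.ofReal ((1 / ((m + 1 : ℕ) * (x + τ))) ^ lam * Gamma lam) =
        ENNReal.ofReal ((1 / (m + 1 : ℕ)) ^ lam * Gamma lam) *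
          ENNReal.ofReal ((x + (τ : ℝ)) ^ (-lam)) := fun m x hx τ => by
    have hxτ : 0 < x + (τ : ℝ) := by positivity
    have hΓ := Gamma_pos_of_pos hlam
    rw [← ENNReal.ofReal_mul (by positivity), ← div_div, Real.div_rpow (by positivity)
      hxτ.le, Real.rpow_neg hxτ.le]
    congr 1
    ring
  let ν' : ℕ → Measure ℝ≥0 := fun m =>
    ENNReal.ofReal ((1 / (m + 1 : ℕ)) ^ lam * Gamma lam) • ν m
  have hν' : ∀ (m : ℕ) {x : ℝ}, 0 < x → ∫⁻ τ, ENNReal.ofReal ((x + (τ : ℝ)) ^ (-lam)) ∂ν' m =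
      ∫⁻ τ : ℝ≥0, ENNReal.ofReal ((1 / ((m + 1 : ℕ) * (x + τ))) ^ lam * Gamma lam) ∂ν m :=
    fun m x hx => by
      rw [lintegral_smul_measure, smul_eq_mul, ← lintegral_const_mul _ (by fun_prop)]
      exact lintegral_congr fun τ => (hkernel m hx τ).symm
  have ht : ∀ x, 0 < x → Tendsto (fun m => ∫⁻ τ, ENNReal.ofReal ((x + (τ : ℝ)) ^ (-lam)) ∂ν' m)
      atTop (𝓝 (ENNReal.ofReal (A 0 0 x - L))) := fun x hx => by
    have hdiv : Tendsto (fun m => ENNReal.ofReal (A 0 0 x - L) / (1 - δ m)) atTop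
        (𝓝 (ENNReal.ofReal (A 0 0 x - L))) := by
      simpa using ENNReal.Tendsto.div tendsto_const_nhds (Or.inr one_ne_zero) hδ0
        (Or.inr ENNReal.ofReal_ne_top)
    refine tendsto_of_tendsto_of_tendsto_of_le_of_le' tendsto_const_nhds hdiv
      (Eventually.of_forall fun m => ?_) ?_
    · rw [hν' m hx, hν m x hx]
      exact lintegral_mono fun τ => truncatedKernel_le hlam m.succ_ne_zero hx τ.2
    · filter_upwards [hδ0.eventually_ne one_ne_zero] with m hm
      rw [ENNReal.le_div_iff_mul_le (Or.inl hm)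
        (Or.inl (ne_top_of_le_ne_top ENNReal.one_ne_top tsub_le_self)), mul_comm, hν' m hx,
        hν m x hx, ← lintegral_const_mul _ (by fun_prop)]
      exact lintegral_mono fun τ => le_truncatedKernel hlam m.succ_ne_zero hx τ.2
  obtain ⟨c, hc, μ, hμ, hgμ⟩ := exists_stieltjes_of_tendsto hLle ht
  exact ⟨L + c, add_nonneg hL0 hc, μ, hμ, fun x hx => by linarith [hgμ x hx]⟩

theorem hasDerivAt_iteratedDerivWithin_Ioi {φ : ℝ → ℝ} (hφ : ContDiffOn ℝ (⊤ : ℕ∞) φ (Ioi 0))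
    (n : ℕ) {x : ℝ} (hx : 0 < x) :
    HasDerivAt (iteratedDerivWithin n φ (Ioi 0)) (iteratedDerivWithin (n + 1) φ (Ioi 0) x) x := by
  have hd := hφ.differentiableOn_iteratedDerivWithin (m := n)
    (by exact_mod_cast WithTop.coe_lt_top n) (uniqueDiffOn_Ioi 0) x hx
  rw [iteratedDerivWithin_succ]
  exact hd.hasDerivWithinAt.hasDerivAt (Ioi_mem_nhds hx)

theorem iteratedDerivWithin_succ_id_mul_Ioi {u : ℝ → ℝ} (hu : ContDiffOn ℝ (⊤ : ℕ∞) u (Ioi 0))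
    (k : ℕ) {x : ℝ} (hx : 0 < x) :
    iteratedDerivWithin (k + 1) (fun t => t * u t) (Ioi 0) x =
      x * iteratedDerivWithin (k + 1) u (Ioi 0) x + (k + 1) * iteratedDerivWithin k u (Ioi 0) x := by
  have hv : ContDiffOn ℝ (⊤ : ℕ∞) (fun t => t * u t) (Ioi 0) := contDiffOn_id.mul hu
  induction k generalizing x with
  | zero =>
    refine (hasDerivAt_iteratedDerivWithin_Ioi hv 0 hx).unique ?_
    have h := (hasDerivAt_id x).mul (hasDerivAt_iteratedDerivWithin_Ioi hu 0 hx)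
    simp only [iteratedDerivWithin_zero] at h ⊢
    refine h.congr_deriv ?_
    simp only [id]
    push_cast
    ring
  | succ k ih =>
    refine (hasDerivAt_iteratedDerivWithin_Ioi hv (k + 1) hx).unique ?_
    have h := ((hasDerivAt_id x).mul (hasDerivAt_iteratedDerivWithin_Ioi hu (k + 1) hx)).add
      ((hasDerivAt_iteratedDerivWithin_Ioi hu k hx).const_mul ((k : ℝ) + 1))
    refine (h.congr_of_eventuallyEq ?_).congr_deriv ?_
    · filter_upwards [Ioi_mem_nhds hx] with y hy
      exact ih hy
    · simp only [id]
      push_cast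
      ring

theorem stieltjesFamily_iteratedDerivWithin {lam : ℝ} {f : ℝ → ℝ}
    (hf : ContDiffOn ℝ (⊤ : ℕ∞) f (Ioi 0))
    (h : ∀ k : ℕ, CompletelyMonotonic
      (fun x => x ^ (1 - lam) *
        iteratedDerivWithin k (fun t => t ^ (lam - 1 + (k : ℝ)) * f t) (Ioi 0) x)) :
    StieltjesFamily lam fun n k x => (-1) ^ n * iteratedDerivWithin n (fun x => x ^ (1 - lam) *
        iteratedDerivWithin k (fun t => t ^ (lam - 1 + (k : ℝ)) * f t) (Ioi 0) x) (Ioi 0) x := by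
  set c : ℕ → ℝ → ℝ := fun k x => x ^ (1 - lam) *
    iteratedDerivWithin k (fun t => t ^ (lam - 1 + (k : ℝ)) * f t) (Ioi 0) x with hc
  have hderiv : ∀ n k x, 0 < x →
      HasDerivAt (fun x => (-1) ^ n * iteratedDerivWithin n (c k) (Ioi 0) x)
        (-((-1) ^ (n + 1) * iteratedDerivWithin (n + 1) (c k) (Ioi 0) x)) x := fun n k x hx =>
    ((hasDerivAt_iteratedDerivWithin_Ioi (h k).1 n hx).const_mul _).congr_deriv (by ring)
  refine ⟨hderiv, fun n k => (h k).2 n, fun n k => ?_⟩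
  change ∀ x, 0 < x → (-1) ^ n * iteratedDerivWithin n (c (k + 1)) (Ioi 0) x =
    (lam + n + k) * ((-1) ^ n * iteratedDerivWithin n (c k) (Ioi 0) x) -
      x * ((-1) ^ (n + 1) * iteratedDerivWithin (n + 1) (c k) (Ioi 0) x)
  induction n with
  | zero =>
    intro x hx
    have hu : ContDiffOn ℝ (⊤ : ℕ∞) (fun t => t ^ (lam - 1 + (k : ℝ)) * f t) (Ioi 0) :=
      (contDiffOn_id.rpow_const_of_ne fun t ht => ne_of_gt ht).mul hf
    have hcongr : EqOn (fun t => t ^ (lam - 1 + ((k + 1 : ℕ) : ℝ)) * f t)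
        (fun t => t * (t ^ (lam - 1 + (k : ℝ)) * f t)) (Ioi 0) := fun t ht => by
      simp only
      rw [Nat.cast_succ, ← add_assoc, Real.rpow_add_one (ne_of_gt ht)]
      ring
    have hstep : c (k + 1) x = x ^ (1 - lam) *
        (x * iteratedDerivWithin (k + 1) (fun t => t ^ (lam - 1 + (k : ℝ)) * f t) (Ioi 0) x +
          (k + 1) * iteratedDerivWithin k (fun t => t ^ (lam - 1 + (k : ℝ)) * f t) (Ioi 0) x) := by
      rw [hc, ← iteratedDerivWithin_succ_id_mul_Ioi hu k hx]
      simp only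
      rw [iteratedDerivWithin_congr hcongr hx]
    have hone : iteratedDerivWithin (0 + 1) (c k) (Ioi 0) x = (1 - lam) * x ^ (1 - lam - 1) *
        iteratedDerivWithin k (fun t => t ^ (lam - 1 + (k : ℝ)) * f t) (Ioi 0) x + x ^ (1 - lam) *
        iteratedDerivWithin (k + 1) (fun t => t ^ (lam - 1 + (k : ℝ)) * f t) (Ioi 0) x :=
      (hasDerivAt_iteratedDerivWithin_Ioi (h k).1 0 hx).unique
      (((Real.hasDerivAt_rpow_const (p := 1 - lam) (Or.inl hx.ne')).mul
        (hasDerivAt_iteratedDerivWithin_Ioi hu k hx)).congr_of_eventuallyEq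
          (Eventually.of_forall fun y => rfl))
    simp only [iteratedDerivWithin_zero, hstep]
    rw [hone, Real.rpow_sub_one hx.ne']
    simp only [hc, pow_zero, zero_add, pow_one, Nat.cast_zero]
    field_simp
    ring
  | succ n ih =>
    intro x hx
    have h1 := hderiv n (k + 1) x hx
    have h2 := ((hderiv n k x hx).const_mul (lam + n + k)).sub
      ((hasDerivAt_id x).mul (hderiv (n + 1) k x hx))
    have h3 := h1.unique (h2.congr_of_eventuallyEq <| by
      filter_upwards [Ioi_mem_nhds hx] with y hy using ih y hy)
    simp only [id] at h3
    push_cast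
    linear_combination -h3

theorem stieltjes_of_ck_completely_monotonic (lam : ℝ) (hlam : 0 < lam) (f : ℝ → ℝ)
    (hf : ContDiffOn ℝ (⊤ : ℕ∞) f (Set.Ioi 0))
    (h : ∀ k : ℕ, CompletelyMonotonic
      (fun x => x ^ (1 - lam) *
        iteratedDerivWithin k (fun t => t ^ (lam - 1 + (k : ℝ)) * f t) (Set.Ioi 0) x)) :
    ∃ c : ℝ, 0 ≤ c ∧ ∃ μ : Measure ℝ,
      (∀ x : ℝ, 0 < x → IntegrableOn (fun t => (x + t) ^ (-lam)) (Set.Ici 0) μ) ∧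
      (∀ x : ℝ, 0 < x → f x = c + ∫ t in Set.Ici 0, (x + t) ^ (-lam) ∂μ) := by
  obtain ⟨c, hc, μ, hμ, hfμ⟩ := (stieltjesFamily_iteratedDerivWithin hf h).exists_stieltjes hlam
  refine ⟨c, hc, μ, hμ, fun x hx => ?_⟩
  rw [← hfμ x hx]
  simp only [pow_zero, one_mul, iteratedDerivWithin_zero, Nat.cast_zero, add_zero]
  rw [← mul_assoc, ← Real.rpow_add hx]
  simp
end

section
/- Let λ > 0 and let g be a nonnegative C^∞ function on (0,∞). Then x^{1-λ} g'(x) is completely monotonic on (0,∞) if and only if g(x) = α x^λ + β + ∫₀^∞ (∫₀^{xt} e^{-u} u^{λ-1} du) t^{-λ} dμ(t) for some α, β ≥ 0 and some positive measure μ on (0,∞) making the integral convergent. -/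
open Real Set MeasureTheory

open Filter Topology ProbabilityTheory
open scoped Nat ENNReal NNReal

namespace CompletelyMonotonic

variable {f : ℝ → ℝ}

/-- The `n`-th Taylor coefficient of `f` at `a` in powers of `a - x`. -/
noncomputable def coeff (f : ℝ → ℝ) (a : ℝ) (n : ℕ) : ℝ :=
  (-1 : ℝ) ^ n * iteratedDerivWithin n f (Ioi 0) a / n !

lemma coeff_nonneg (hf : CompletelyMonotonic f) {a : ℝ} (ha : 0 < a) (n : ℕ) :
    0 ≤ coeff f a n :=
  div_nonneg (hf.2 n a ha) (by positivity)

protected lemma congr {g : ℝ → ℝ} (hf : CompletelyMonotonic f) (h : EqOn g f (Ioi 0)) :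
    CompletelyMonotonic g := by
  refine ⟨hf.1.congr h, fun n x hx => ?_⟩
  rw [iteratedDerivWithin_congr h (mem_Ioi.2 hx)]
  exact hf.2 n x hx

lemma iteratedDerivWithin_uIcc (hf : ContDiffOn ℝ (⊤ : ℕ∞) f (Ioi 0)) {a b x : ℝ} (ha : 0 < a)
    (hb : 0 < b) (hab : a ≠ b) (hx : x ∈ uIcc a b) (n : ℕ) :
    iteratedDerivWithin n f (uIcc a b) x = iteratedDerivWithin n f (Ioi 0) x := by
  have hx0 : x ∈ Ioi (0 : ℝ) := lt_of_lt_of_le (lt_min ha hb) hx.1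
  rw [iteratedDerivWithin_of_isOpen isOpen_Ioi hx0]
  refine iteratedDerivWithin_eq_iteratedDeriv (uniqueDiffOn_Icc (by simpa using hab.symm)) ?_ hx
  exact ((hf x hx0).contDiffAt (isOpen_Ioi.mem_nhds hx0)).of_le (by exact_mod_cast le_top)

lemma uIcc_subset {a b : ℝ} (ha : 0 < a) (hb : 0 < b) : uIcc a b ⊆ Ioi 0 :=
  fun _ hx => lt_of_lt_of_le (lt_min ha hb) hx.1

lemma differentiableOn_iteratedDerivWithin_uIcc (hf : ContDiffOn ℝ (⊤ : ℕ∞) f (Ioi 0)) {a b : ℝ}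
    (ha : 0 < a) (hb : 0 < b) (hab : a ≠ b) (n : ℕ) :
    DifferentiableOn ℝ (iteratedDerivWithin n f (uIcc a b)) (uIoo a b) := by
  refine DifferentiableOn.mono ?_ uIoo_subset_uIcc_self
  exact (hf.mono (uIcc_subset ha hb)).differentiableOn_iteratedDerivWithin
    (by exact_mod_cast WithTop.coe_lt_top n) (uniqueDiffOn_Icc (by simpa using hab.symm))

lemma taylorWithinEval_eq_sum (hf : ContDiffOn ℝ (⊤ : ℕ∞) f (Ioi 0)) {a b : ℝ}
    (ha : 0 < a) (hb : 0 < b) (hab : a ≠ b) (n : ℕ) :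
    taylorWithinEval f n (uIcc a b) a b = ∑ k ∈ Finset.range (n + 1), coeff f a k * (a - b) ^ k := by
  rw [taylor_within_apply]
  refine Finset.sum_congr rfl fun k _ => ?_
  rw [iteratedDerivWithin_uIcc hf ha hb hab left_mem_uIcc, coeff, smul_eq_mul,
    ← neg_sub a b, neg_pow]
  ring

lemma coeff_mul_pow_le (hf : CompletelyMonotonic f) {a b : ℝ} (hb : 0 < b) (hab : b < a) (n : ℕ) :
    coeff f a n * (a - b) ^ n ≤ f b := by
  have ha : 0 < a := hb.trans hab
  obtain ⟨y, hy, h⟩ := taylor_mean_remainder_lagrange (n := n) hab.ne'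
    ((hf.1.mono (uIcc_subset ha hb)).of_le (by exact_mod_cast le_top))
    (differentiableOn_iteratedDerivWithin_uIcc hf.1 ha hb hab.ne' n)
  have hy0 := uIcc_subset ha hb (uIoo_subset_uIcc_self hy)
  rw [iteratedDerivWithin_uIcc hf.1 ha hb hab.ne' (uIoo_subset_uIcc_self hy),
    taylorWithinEval_eq_sum hf.1 ha hb hab.ne', ← neg_sub a b, neg_pow] at h
  have h1 : 0 ≤ coeff f y (n + 1) * (a - b) ^ (n + 1) :=
    mul_nonneg (hf.coeff_nonneg hy0 _) (pow_nonneg (sub_nonneg.2 hab.le) _)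
  have h2 : coeff f a n * (a - b) ^ n ≤
      ∑ k ∈ Finset.range (n + 1), coeff f a k * (a - b) ^ k :=
    Finset.single_le_sum (f := fun k => coeff f a k * (a - b) ^ k)
      (fun k _ => mul_nonneg (hf.coeff_nonneg ha _) (pow_nonneg (sub_nonneg.2 hab.le) _))
      (Finset.self_mem_range_succ n)
  have h3 : coeff f y (n + 1) * (a - b) ^ (n + 1) =
      iteratedDerivWithin (n + 1) f (Ioi 0) y * ((-1) ^ (n + 1) * (a - b) ^ (n + 1)) / (n + 1)! := by
    rw [coeff]; ring
  linarith

lemma taylor_remainder_bound (hf : CompletelyMonotonic f) {a b : ℝ} (hb : 0 < b) (hab : b < a)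
    (n : ℕ) :
    |f b - ∑ k ∈ Finset.range (n + 1), coeff f a k * (a - b) ^ k| ≤
      (n + 1) * ((a - b) / (a - b / 2)) ^ n * (f (b / 2) * (a - b) / (b / 2)) := by
  have ha : 0 < a := hb.trans hab
  obtain ⟨y, hy, h⟩ := taylor_mean_remainder_cauchy (n := n) hab.ne'
    ((hf.1.mono (uIcc_subset ha hb)).of_le (by exact_mod_cast le_top))
    (differentiableOn_iteratedDerivWithin_uIcc hf.1 ha hb hab.ne' n)
  have hy0 : 0 < y := uIcc_subset ha hb (uIoo_subset_uIcc_self hy)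
  rw [iteratedDerivWithin_uIcc hf.1 ha hb hab.ne' (uIoo_subset_uIcc_self hy),
    taylorWithinEval_eq_sum hf.1 ha hb hab.ne'] at h
  rw [uIoo_of_ge hab.le] at hy
  obtain ⟨hby, hya⟩ := hy
  have hn : ((n + 1)! : ℝ) = (n + 1) * n ! := by push_cast [Nat.factorial_succ]; ring
  have h3 : iteratedDerivWithin (n + 1) f (Ioi 0) y * (b - y) ^ n / n ! * (b - a) =
      (n + 1) * coeff f y (n + 1) * (y - b) ^ n * (a - b) := by
    rw [coeff, hn, ← neg_sub y b, neg_pow]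
    field_simp
    ring
  have hyb : 0 < y - b / 2 := by linarith
  have hc0 := hf.coeff_nonneg hy0 (n + 1)
  have hc : coeff f y (n + 1) ≤ f (b / 2) / (y - b / 2) ^ (n + 1) := by
    rw [le_div_iff₀ (by positivity)]
    exact hf.coeff_mul_pow_le (by linarith) (by linarith) (n + 1)
  have hfb : 0 ≤ f (b / 2) := by simpa using hf.2 0 (b / 2) (by linarith)
  have hyb' : 0 ≤ y - b := by linarith
  have hab' : 0 ≤ a - b := by linarith
  rw [h, h3, abs_of_nonneg (by positivity)]
  have h4 : (y - b) / (y - b / 2) ≤ (a - b) / (a - b / 2) := by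
    rw [div_le_div_iff₀ hyb (by linarith)]
    nlinarith
  calc (n + 1) * coeff f y (n + 1) * (y - b) ^ n * (a - b)
      ≤ (n + 1) * (f (b / 2) / (y - b / 2) ^ (n + 1)) * (y - b) ^ n * (a - b) := by gcongr
    _ = (n + 1) * ((y - b) / (y - b / 2)) ^ n * (f (b / 2) * (a - b) / (y - b / 2)) := by
        rw [div_pow, pow_succ]; field [pow_ne_zero n hyb.ne']
    _ ≤ (n + 1) * ((a - b) / (a - b / 2)) ^ n * (f (b / 2) * (a - b) / (b / 2)) := by
        have hb2 : b / 2 ≤ y - b / 2 := by linarith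
        have hr : 0 ≤ (a - b) / (a - b / 2) := div_nonneg hab' (by linarith)
        gcongr

/-- A completely monotonic function is the sum of its Taylor series at `a` on `(0, a]`. -/
lemma hasSum_taylor_s10 (hf : CompletelyMonotonic f) {a b : ℝ} (hb : 0 < b) (hab : b < a) :
    HasSum (fun k => coeff f a k * (a - b) ^ k) (f b) := by
  have ha : 0 < a := hb.trans hab
  rw [hasSum_iff_tendsto_nat_of_nonneg
    (fun k => mul_nonneg (hf.coeff_nonneg ha _) (pow_nonneg (sub_nonneg.2 hab.le) _)),
    ← tendsto_add_atTop_iff_nat 1, tendsto_iff_norm_sub_tendsto_zero]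
  set r := (a - b) / (a - b / 2)
  have hr0 : 0 ≤ r := div_nonneg (by linarith) (by linarith)
  have hr1 : r < 1 := (div_lt_one (by linarith)).2 (by linarith)
  have key : Tendsto (fun n : ℕ => ((n : ℝ) + 1) * r ^ n * (f (b / 2) * (a - b) / (b / 2)))
      atTop (𝓝 0) := by
    have := ((tendsto_self_mul_const_pow_of_lt_one hr0 hr1).add
      (tendsto_pow_atTop_nhds_zero_of_lt_one hr0 hr1)).mul_const (f (b / 2) * (a - b) / (b / 2))
    simpa [add_mul] using this
  refine squeeze_zero (fun _ => norm_nonneg _) (fun n => ?_) key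
  rw [norm_sub_rev, Real.norm_eq_abs]
  exact hf.taylor_remainder_bound hb hab n

/-- The discrete measure on `[0, 1]` with mass `coeff f (1 + a) k * a ^ k` at `exp (-k / a)`. -/
noncomputable def discreteMeasure (f : ℝ → ℝ) (a : ℝ≥0) : Measure unitInterval :=
  Measure.sum fun k : ℕ => ENNReal.ofReal (coeff f (1 + a) k * (a : ℝ) ^ k) •
    Measure.dirac ⟨exp (-(k / a)), (exp_pos _).le, exp_le_one_iff.2 (neg_nonpos.2 (by positivity))⟩

lemma discreteMeasure_univ (hf : CompletelyMonotonic f) {a : ℝ≥0} (ha : 0 < a) :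
    discreteMeasure f a univ = ENNReal.ofReal (f 1) := by
  have ha' : (0 : ℝ) < a := ha
  have h := hf.hasSum_taylor_s10 (a := 1 + a) one_pos (by linarith)
  rw [add_sub_cancel_left] at h
  rw [discreteMeasure, Measure.sum_apply _ MeasurableSet.univ, ← h.tsum_eq,
    ENNReal.ofReal_tsum_of_nonneg _ h.summable]
  · simp
  · exact fun k => mul_nonneg (hf.coeff_nonneg (by positivity) _) (by positivity)

lemma integral_rpow_discreteMeasure (hf : CompletelyMonotonic f) {a : ℝ≥0} (ha : 0 < a) {x : ℝ}
    (hx : 0 ≤ x) :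
    ∫ y : unitInterval, (y : ℝ) ^ x ∂(discreteMeasure f a) =
      f (1 + a * (1 - exp (-(x / a)))) := by
  have ha' : (0 : ℝ) < a := ha
  have hfin : IsFiniteMeasure (discreteMeasure f a) :=
    ⟨by rw [hf.discreteMeasure_univ ha]; exact ENNReal.ofReal_lt_top⟩
  have hcont : Continuous fun y : unitInterval => (y : ℝ) ^ x :=
    (continuous_rpow_const hx).comp continuous_subtype_val
  have hinteg : Integrable (fun y : unitInterval => (y : ℝ) ^ x) (discreteMeasure f a) :=
    Integrable.of_bound hcont.aestronglyMeasurable 1 (ae_of_all _ fun y => by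
      rw [Real.norm_eq_abs, abs_of_nonneg (rpow_nonneg y.2.1 _)]
      exact rpow_le_one y.2.1 y.2.2 hx)
  have h1 := hasSum_integral_measure hinteg
  have hle : exp (-(x / a)) ≤ 1 := exp_le_one_iff.2 (neg_nonpos.2 (by positivity))
  have hnn : 0 ≤ a * (1 - exp (-(x / a))) := mul_nonneg ha'.le (by linarith)
  have h2 := hf.hasSum_taylor_s10 (a := 1 + a) (b := 1 + a * (1 - exp (-(x / a)))) (by linarith)
    (by nlinarith [exp_pos (-(x / a))])
  have h3 : (1 + (a : ℝ) - (1 + a * (1 - exp (-(x / a))))) = a * exp (-(x / a)) := by ring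
  rw [h3] at h2
  have h4 : ∀ k : ℕ, ∫ y : unitInterval, (y : ℝ) ^ x
      ∂(ENNReal.ofReal (coeff f (1 + a) k * (a : ℝ) ^ k) • Measure.dirac
        (⟨exp (-(k / a)), (exp_pos _).le, exp_le_one_iff.2 (neg_nonpos.2 (by positivity))⟩ :
          unitInterval)) = coeff f (1 + a) k * (a * exp (-(x / a))) ^ k := fun k => by
    rw [integral_smul_measure, integral_dirac, ENNReal.toReal_ofReal
      (mul_nonneg (hf.coeff_nonneg (by positivity) _) (by positivity)), smul_eq_mul, ← exp_mul,
      mul_pow, ← exp_nat_mul, mul_assoc]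
    congr 3
    ring
  simp only [h4] at h1
  exact h1.unique h2

lemma tendsto_mul_one_sub_exp (x : ℝ) :
    Tendsto (fun n : ℕ => ((n : ℝ) + 1) * (1 - exp (-(x / ((n : ℝ) + 1))))) atTop (𝓝 x) := by
  have hd : HasDerivAt (fun u : ℝ => -exp (-(x * u))) x 0 := by
    have := (((hasDerivAt_id (0 : ℝ)).const_mul x).neg.exp).neg
    simp at this
    exact this
  rw [hasDerivAt_iff_tendsto_slope_zero] at hd
  have hu : Tendsto (fun n : ℕ => 1 / ((n : ℝ) + 1)) atTop (𝓝[≠] 0) :=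
    tendsto_nhdsWithin_iff.2 ⟨tendsto_one_div_add_atTop_nhds_zero_nat,
      Eventually.of_forall fun n => by simp; positivity⟩
  refine (hd.comp hu).congr fun n => ?_
  simp only [Function.comp_apply, zero_add, mul_zero, neg_zero, exp_zero, smul_eq_mul, one_mul,
    inv_inv, div_eq_mul_inv]
  ring

/-- The values on `(1, ∞)` of a completely monotonic function are moments of a finite measure. -/
lemma exists_unitInterval_measure (hf : CompletelyMonotonic f) :
    ∃ ν : FiniteMeasure unitInterval, ∀ x : ℝ, 0 < x →
      f (1 + x) = ∫ y : unitInterval, (y : ℝ) ^ x ∂(ν : Measure unitInterval) := by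
  let a : ℕ → ℝ≥0 := fun n => n + 1
  have ha : ∀ n, 0 < a n := fun n => by positivity
  let ν : ℕ → FiniteMeasure unitInterval := fun n => ⟨discreteMeasure f (a n),
    ⟨by rw [hf.discreteMeasure_univ (ha n)]; exact ENNReal.ofReal_lt_top⟩⟩
  have hν : ∀ n, (ν n).mass ≤ (f 1).toNNReal := fun n => by
    rw [← ENNReal.coe_le_coe, FiniteMeasure.ennreal_mass]
    exact (hf.discreteMeasure_univ (ha n)).le
  obtain ⟨ν', -, hν'⟩ := (isCompact_setOfPred_finiteMeasure_le_of_compactSpace unitInterval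
    (f 1).toNNReal).exists_mapClusterPt (f := atTop) (u := ν)
      (tendsto_principal.2 (Eventually.of_forall hν))
  refine ⟨ν', fun x hx => ?_⟩
  let h : BoundedContinuousFunction unitInterval ℝ := BoundedContinuousFunction.mkOfCompact
    ⟨fun y => (y : ℝ) ^ x, (continuous_rpow_const hx.le).comp continuous_subtype_val⟩
  have hc := hν'.continuousAt_comp
    (FiniteMeasure.continuous_integral_boundedContinuousFunction h).continuousAt
  have hlim : Tendsto (fun n => ∫ y : unitInterval, (y : ℝ) ^ x ∂(ν n : Measure unitInterval))
      atTop (𝓝 (f (1 + x))) := by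
    have hfx : ContinuousAt f (1 + x) :=
      hf.1.continuousOn.continuousAt (isOpen_Ioi.mem_nhds (by simp; linarith))
    have := hfx.tendsto.comp ((tendsto_mul_one_sub_exp x).const_add 1)
    refine this.congr fun n => ?_
    rw [Function.comp_apply]
    have := hf.integral_rpow_discreteMeasure (ha n) hx.le
    rw [show (a n : ℝ) = n + 1 by simp [a]] at this
    exact this.symm
  obtain ⟨s, hs, hs'⟩ := hc.tendsto_subseq
  exact tendsto_nhds_unique (hlim.comp hs.tendsto_atTop) hs'

/-- Bernstein's representation on `(1, ∞)`. -/
lemma exists_laplace_measure_Ioi_one (hf : CompletelyMonotonic f) :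
    ∃ P : Measure ℝ, SFinite P ∧ (∀ᵐ t ∂P, 0 ≤ t) ∧ ∀ x : ℝ, 1 < x →
      Integrable (fun t => exp (-(x * t))) P ∧ f x = ∫ t, exp (-(x * t)) ∂P := by
  obtain ⟨ν, hν⟩ := hf.exists_unitInterval_measure
  let S : Set unitInterval := {y | 0 < (y : ℝ)}
  have hS : MeasurableSet S := measurableSet_lt measurable_const measurable_subtype_coe
  let l : unitInterval → ℝ := fun y => -log y
  have hl : Measurable l := (measurable_log.comp measurable_subtype_coe).neg
  let M : Measure ℝ := ((ν : Measure unitInterval).restrict S).map l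
  have hd : Measurable fun t : ℝ => ENNReal.ofReal (exp t) := by fun_prop
  refine ⟨M.withDensity fun t => ENNReal.ofReal (exp t), inferInstance, ?_, fun x hx => ?_⟩
  · refine (withDensity_absolutelyContinuous _ _).ae_le ?_
    refine (ae_map_iff hl.aemeasurable measurableSet_Ici).2 ?_
    exact ae_of_all _ fun y => neg_nonneg.2 (log_nonpos y.2.1 y.2.2)
  · have hx' : 0 < x - 1 := by linarith
    have hfun : ∀ y ∈ S, exp (l y) * exp (-(x * l y)) = (y : ℝ) ^ (x - 1) := fun y hy => by
      rw [← exp_add, rpow_def_of_pos hy]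
      congr 1
      simp only [l]
      ring
    have hcont : Continuous fun y : unitInterval => (y : ℝ) ^ (x - 1) :=
      (continuous_rpow_const hx'.le).comp continuous_subtype_val
    have hinteg : Integrable (fun y : unitInterval => (y : ℝ) ^ (x - 1))
        (ν : Measure unitInterval) :=
      Integrable.of_bound hcont.aestronglyMeasurable 1 (ae_of_all _ fun y => by
        rw [Real.norm_eq_abs, abs_of_nonneg (rpow_nonneg y.2.1 _)]
        exact rpow_le_one y.2.1 y.2.2 hx'.le)
    have hsm : AEStronglyMeasurable (fun t : ℝ => exp t * exp (-(x * t))) M := by fun_prop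
    constructor
    · rw [integrable_withDensity_iff_integrable_smul' hd (by simp)]
      simp only [ENNReal.toReal_ofReal (exp_pos _).le, smul_eq_mul]
      rw [integrable_map_measure hsm hl.aemeasurable]
      exact (integrableOn_congr_fun hfun hS).2 hinteg.integrableOn
    · rw [integral_withDensity_eq_integral_toReal_smul hd (by simp)]
      simp only [ENNReal.toReal_ofReal (exp_pos _).le, smul_eq_mul]
      rw [integral_map hl.aemeasurable hsm, setIntegral_congr_fun hS hfun,
        setIntegral_eq_integral_of_forall_compl_eq_zero, ← hν _ hx', add_sub_cancel]
      intro y hy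
      rw [le_antisymm (not_lt.1 hy) y.2.1, zero_rpow hx'.ne']

lemma Ioi_subset_interior_integrableExpSet {P : Measure ℝ} {c : ℝ}
    (h : ∀ x : ℝ, c < x → Integrable (fun t => exp (-(x * t))) P) :
    Ioi c ⊆ interior (integrableExpSet (fun t : ℝ => -t) P) :=
  interior_maximal (fun x hx => by simpa [integrableExpSet] using h x hx) isOpen_Ioi

lemma iteratedDerivWithin_mgf {P : Measure ℝ} {c x : ℝ} (hc : 0 ≤ c)
    (h : ∀ x : ℝ, c < x → Integrable (fun t => exp (-(x * t))) P)
    (hfP : ∀ x : ℝ, c < x → f x = ∫ t, exp (-(x * t)) ∂P) (hx : c < x) (n : ℕ) :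
    iteratedDerivWithin n f (Ioi 0) x = ∫ t, (-t) ^ n * exp (-(x * t)) ∂P := by
  have hfm : f =ᶠ[𝓝 x] mgf (fun t : ℝ => -t) P := by
    filter_upwards [Ioi_mem_nhds hx] with y hy
    simp [hfP y hy, mgf]
  rw [iteratedDerivWithin_of_isOpen isOpen_Ioi (mem_Ioi.2 (hc.trans_lt hx)),
    hfm.iteratedDeriv_eq, iteratedDeriv_mgf (Ioi_subset_interior_integrableExpSet h hx)]
  simp

lemma integrable_pow_mul_exp {P : Measure ℝ} {c x : ℝ}
    (h : ∀ x : ℝ, c < x → Integrable (fun t => exp (-(x * t))) P) (hx : c < x) (n : ℕ) :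
    Integrable (fun t => t ^ n * exp (-(x * t))) P := by
  have := (integrable_pow_mul_exp_of_mem_interior_integrableExpSet
    (Ioi_subset_interior_integrableExpSet h hx) n).const_mul ((-1) ^ n)
  refine this.congr (ae_of_all _ fun t => ?_)
  simp only [neg_pow t n, mul_neg, ← mul_assoc, ← mul_pow]
  norm_num

lemma of_laplace {P : Measure ℝ} (hP : ∀ᵐ t ∂P, 0 ≤ t)
    (h : ∀ x : ℝ, 0 < x → Integrable (fun t => exp (-(x * t))) P) :
    CompletelyMonotonic fun x => ∫ t, exp (-(x * t)) ∂P := by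
  constructor
  · have := ((analyticOnNhd_mgf (X := fun t : ℝ => -t) (μ := P)).mono
      (Ioi_subset_interior_integrableExpSet h)).contDiffOn (n := (⊤ : ℕ∞))
      isOpen_Ioi.uniqueDiffOn
    simpa [mgf, Function.comp_def] using this.congr fun x _ => by simp [mgf]
  · intro n x hx
    rw [iteratedDerivWithin_mgf le_rfl h (fun _ _ => rfl) hx, ← integral_const_mul]
    refine integral_nonneg_of_ae ?_
    filter_upwards [hP] with t ht
    rw [← mul_assoc, ← mul_pow]
    simp only [Pi.zero_apply]
    have : 0 ≤ -1 * -t := by linarith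
    positivity

/-- **Bernstein's theorem**: a completely monotonic function on `(0, ∞)` is the Laplace transform
of a measure on `[0, ∞)`. -/
theorem exists_laplace_measure (hf : CompletelyMonotonic f) :
    ∃ P : Measure ℝ, SFinite P ∧ (∀ᵐ t ∂P, 0 ≤ t) ∧ ∀ x : ℝ, 0 < x →
      Integrable (fun t => exp (-(x * t))) P ∧ f x = ∫ t, exp (-(x * t)) ∂P := by
  obtain ⟨P, hsf, hpos, hP⟩ := hf.exists_laplace_measure_Ioi_one
  refine ⟨P, hsf, hpos, fun x hx => ?_⟩
  rcases lt_or_ge 1 x with hx1 | hx1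
  · exact hP x hx1
  have hcoeff : ∀ k, coeff f 2 k * (2 - x) ^ k =
      ∫ t, (2 - x) ^ k / k ! * (t ^ k * exp (-(2 * t))) ∂P := fun k => by
    rw [coeff, iteratedDerivWithin_mgf zero_le_one (fun x hx => (hP x hx).1)
      (fun x hx => (hP x hx).2) one_lt_two, integral_const_mul, ← integral_const_mul ((-1) ^ k)]
    simp only [← mul_assoc, ← mul_pow, neg_mul_neg, one_mul]
    ring
  have hsum := hf.hasSum_taylor_s10 hx (show x < 2 by linarith)
  have hnn : ∀ k, ∀ᵐ t ∂P, 0 ≤ (2 - x) ^ k / k ! * (t ^ k * exp (-(2 * t))) := fun k => by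
    filter_upwards [hpos] with t ht
    have : 0 ≤ 2 - x := by linarith
    positivity
  have hexp : ∀ᵐ t ∂P, ENNReal.ofReal (exp (-(x * t))) =
      ∑' k : ℕ, ENNReal.ofReal ((2 - x) ^ k / k ! * (t ^ k * exp (-(2 * t)))) := by
    filter_upwards [ae_all_iff.2 hnn] with t ht
    have h1 : HasSum (fun k : ℕ => (2 - x) ^ k / k ! * (t ^ k * exp (-(2 * t))))
        (exp (-(x * t))) := by
      have := (NormedSpace.expSeries_div_hasSum_exp ((2 - x) * t)).mul_right (exp (-(2 * t)))
      rw [← Real.exp_eq_exp_ℝ, ← exp_add] at this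
      rw [show -(x * t) = (2 - x) * t + -(2 * t) by ring]
      have hterm : ∀ k : ℕ, ((2 - x) * t) ^ k / k ! * exp (-(2 * t)) =
          (2 - x) ^ k / k ! * (t ^ k * exp (-(2 * t))) := fun k => by rw [mul_pow]; ring
      simpa only [hterm] using this
    rw [← h1.tsum_eq, ENNReal.ofReal_tsum_of_nonneg ht h1.summable]
  have hl : ∫⁻ t, ENNReal.ofReal (exp (-(x * t))) ∂P = ENNReal.ofReal (f x) := by
    rw [lintegral_congr_ae hexp, lintegral_tsum fun k => by fun_prop, ← hsum.tsum_eq,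
      ENNReal.ofReal_tsum_of_nonneg _ hsum.summable]
    · refine tsum_congr fun k => ?_
      rw [hcoeff, ofReal_integral_eq_lintegral_ofReal _ (hnn k)]
      exact (integrable_pow_mul_exp (fun x hx => (hP x hx).1) one_lt_two k).const_mul _
    · exact fun k => mul_nonneg (hf.coeff_nonneg two_pos k) (pow_nonneg (by linarith) k)
  have hm : AEStronglyMeasurable (fun t : ℝ => exp (-(x * t))) P := by fun_prop
  have hen : 0 ≤ᵐ[P] fun t : ℝ => exp (-(x * t)) := ae_of_all _ fun t => (exp_pos _).le
  refine ⟨⟨hm, ?_⟩, ?_⟩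
  · rw [hasFiniteIntegral_iff_ofReal hen, hl]
    exact ENNReal.ofReal_lt_top
  · rw [integral_eq_lintegral_of_nonneg_ae hen hm, hl, ENNReal.toReal_ofReal]
    simpa using hf.2 0 x hx

end CompletelyMonotonic

lemma intervalIntegrable_exp_mul_rpow {lam : ℝ} (hlam : 0 < lam) (x t : ℝ) :
    IntervalIntegrable (fun s => exp (-(s * t)) * s ^ (lam - 1)) volume 0 x :=
  (intervalIntegral.intervalIntegrable_rpow' (by linarith)).continuousOn_mul (by fun_prop)

lemma lowerGamma_mul_rpow_eq {lam : ℝ} {x t : ℝ} (hx : 0 < x) (ht : 0 < t) :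
    (∫ u in Ioc 0 (x * t), exp (-u) * u ^ (lam - 1)) * t ^ (-lam) =
      ∫ s in Ioc 0 x, exp (-(s * t)) * s ^ (lam - 1) := by
  have h := intervalIntegral.integral_comp_mul_right (a := 0) (b := x)
    (fun u => exp (-u) * u ^ (lam - 1)) ht.ne'
  rw [zero_mul, intervalIntegral.integral_of_le hx.le,
    intervalIntegral.integral_of_le (by positivity), smul_eq_mul] at h
  have h2 : ∫ s in Ioc 0 x, exp (-(s * t)) * (s * t) ^ (lam - 1) =
      (∫ s in Ioc 0 x, exp (-(s * t)) * s ^ (lam - 1)) * t ^ (lam - 1) := by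
    rw [← integral_mul_const]
    refine setIntegral_congr_fun measurableSet_Ioc fun s hs => ?_
    simp only [mul_rpow hs.1.le ht.le, mul_assoc]
  rw [h2] at h
  have h3 : t ^ (lam - 1) = t ^ lam * t⁻¹ := by rw [rpow_sub_one ht.ne', div_eq_mul_inv]
  have h4 : t ^ lam ≠ 0 := (rpow_pos_of_pos ht _).ne'
  rw [h3] at h
  rw [rpow_neg ht.le, ← div_eq_mul_inv, div_eq_iff h4]
  field_simp at h
  rw [mul_comm x t]
  exact h.symm

lemma hasDerivAt_lowerGamma_mul_rpow {lam : ℝ} (hlam : 0 < lam) {x t : ℝ} (hx : 0 < x)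
    (ht : 0 < t) :
    HasDerivAt (fun x => (∫ u in Ioc 0 (x * t), exp (-u) * u ^ (lam - 1)) * t ^ (-lam))
      (exp (-(x * t)) * x ^ (lam - 1)) x := by
  have hm : StronglyMeasurable fun s => exp (-(s * t)) * s ^ (lam - 1) := by
    have : Measurable fun s => exp (-(s * t)) * s ^ (lam - 1) := by fun_prop
    exact this.stronglyMeasurable
  have hc : ContinuousAt (fun s => exp (-(s * t)) * s ^ (lam - 1)) x :=
    ContinuousAt.mul (by fun_prop) (continuousAt_rpow_const _ _ (Or.inl hx.ne'))
  refine (intervalIntegral.integral_hasDerivAt_right (intervalIntegrable_exp_mul_rpow hlam x t)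
    hm.stronglyMeasurableAtFilter hc).congr_of_eventuallyEq ?_
  filter_upwards [Ioi_mem_nhds hx] with y hy
  rw [lowerGamma_mul_rpow_eq hy ht, intervalIntegral.integral_of_le (le_of_lt hy)]

lemma exp_neg_mul_le_lowerGamma {lam : ℝ} (hlam : 0 < lam) {x t : ℝ} (hx : 0 < x) (ht : 0 < t) :
    exp (-(x * t)) ≤ lam * x ^ (-lam) *
      ((∫ u in Ioc 0 (x * t), exp (-u) * u ^ (lam - 1)) * t ^ (-lam)) := by
  rw [lowerGamma_mul_rpow_eq hx ht]
  have h1 : ∫ s in Ioc 0 x, s ^ (lam - 1) = x ^ lam / lam := by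
    rw [← intervalIntegral.integral_of_le hx.le, integral_rpow (Or.inl (by linarith))]
    simp [hlam.ne']
  have h2 : exp (-(x * t)) * (x ^ lam / lam) ≤ ∫ s in Ioc 0 x, exp (-(s * t)) * s ^ (lam - 1) := by
    rw [← h1, ← integral_const_mul]
    refine setIntegral_mono_on ?_ ((intervalIntegrable_iff_integrableOn_Ioc_of_le hx.le).1
      (intervalIntegrable_exp_mul_rpow hlam x t)) measurableSet_Ioc fun s hs => ?_
    · exact ((intervalIntegrable_iff_integrableOn_Ioc_of_le hx.le).1
        (intervalIntegral.intervalIntegrable_rpow' (by linarith))).const_mul _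
    · have := hs.1
      have := hs.2
      gcongr
  have h3 : 0 < x ^ lam := rpow_pos_of_pos hx _
  rw [rpow_neg hx.le]
  calc exp (-(x * t)) = lam * (x ^ lam)⁻¹ * (exp (-(x * t)) * (x ^ lam / lam)) := by field_simp
    _ ≤ _ := by gcongr

lemma hasDerivAt_integral_lowerGamma {lam : ℝ} (hlam : 0 < lam) {μ : Measure ℝ}
    (hμ : ∀ x : ℝ, 0 < x → IntegrableOn
      (fun t => (∫ u in Ioc 0 (x * t), exp (-u) * u ^ (lam - 1)) * t ^ (-lam)) (Ioi 0) μ)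
    {x : ℝ} (hx : 0 < x) :
    IntegrableOn (fun t => exp (-(x * t))) (Ioi 0) μ ∧
    HasDerivAt (fun x => ∫ t in Ioi 0,
        (∫ u in Ioc 0 (x * t), exp (-u) * u ^ (lam - 1)) * t ^ (-lam) ∂μ)
      ((∫ t in Ioi 0, exp (-(x * t)) ∂μ) * x ^ (lam - 1)) x := by
  have hexp : ∀ y : ℝ, 0 < y → IntegrableOn (fun t => exp (-(y * t))) (Ioi 0) μ := fun y hy =>
    Integrable.mono' ((hμ y hy).const_mul (lam * y ^ (-lam))) (by fun_prop)
      ((ae_restrict_iff' measurableSet_Ioi).2 (ae_of_all _ fun t ht => by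
        rw [Real.norm_eq_abs, abs_of_pos (exp_pos _)]
        exact exp_neg_mul_le_lowerGamma hlam hy ht))
  refine ⟨hexp x hx, ?_⟩
  obtain ⟨C, hC⟩ := (isCompact_Icc (a := x / 2) (b := x + 1)).exists_bound_of_continuousOn
    (f := fun y : ℝ => y ^ (lam - 1)) (fun y hy => (continuousAt_rpow_const _ _
      (Or.inl (by have := hy.1; linarith))).continuousWithinAt)
  rw [← integral_mul_const]
  refine (hasDerivAt_integral_of_dominated_loc_of_deriv_le
    (F := fun y t => (∫ u in Ioc 0 (y * t), exp (-u) * u ^ (lam - 1)) * t ^ (-lam))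
    (F' := fun y t => exp (-(y * t)) * y ^ (lam - 1))
    (bound := fun t => exp (-(x / 2 * t)) * C)
    (Icc_mem_nhds (show x / 2 < x by linarith) (show x < x + 1 by linarith)) ?_ (hμ x hx) ?_ ?_
    ((hexp (x / 2) (by linarith)).mul_const C) ?_).2
  · filter_upwards [Ioi_mem_nhds hx] with y hy using (hμ y hy).aestronglyMeasurable
  · fun_prop
  · refine (ae_restrict_iff' measurableSet_Ioi).2 (ae_of_all _ fun t ht y hy => ?_)
    rw [norm_mul, Real.norm_eq_abs, abs_of_pos (exp_pos _)]
    have ht0 : 0 ≤ t := le_of_lt ht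
    have := hy.1
    gcongr
    exact hC y hy
  · refine (ae_restrict_iff' measurableSet_Ioi).2 (ae_of_all _ fun t ht y hy => ?_)
    exact hasDerivAt_lowerGamma_mul_rpow hlam (by have := hy.1; linarith) ht

lemma completelyMonotonic_of_representation {lam : ℝ} (hlam : 0 < lam) {g : ℝ → ℝ} {α β : ℝ}
    (hα : 0 ≤ α) {μ : Measure ℝ}
    (hμ : ∀ x : ℝ, 0 < x → IntegrableOn
      (fun t => (∫ u in Ioc 0 (x * t), exp (-u) * u ^ (lam - 1)) * t ^ (-lam)) (Ioi 0) μ)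
    (hgμ : ∀ x : ℝ, 0 < x → g x = α * x ^ lam + β + ∫ t in Ioi 0,
      (∫ u in Ioc 0 (x * t), exp (-u) * u ^ (lam - 1)) * t ^ (-lam) ∂μ) :
    CompletelyMonotonic fun x => x ^ (1 - lam) * deriv g x := by
  let Q : Measure ℝ := μ.restrict (Ioi 0) + ENNReal.ofReal (α * lam) • Measure.dirac 0
  have hi : ∀ x : ℝ, 0 < x → Integrable (fun t => exp (-(x * t))) (μ.restrict (Ioi 0)) :=
    fun x hx => (hasDerivAt_integral_lowerGamma hlam hμ hx).1
  have hd : ∀ x : ℝ, Integrable (fun t => exp (-(x * t)))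
      (ENNReal.ofReal (α * lam) • Measure.dirac 0) := fun x =>
    (integrable_dirac (by simp)).smul_measure ENNReal.ofReal_ne_top
  refine CompletelyMonotonic.congr (CompletelyMonotonic.of_laplace (P := Q) ?_
    fun x hx => (hi x hx).add_measure (hd x)) fun x hx => ?_
  · refine ae_add_measure_iff.2 ⟨?_, Measure.ae_smul_measure ?_ _⟩
    · exact (ae_restrict_iff' measurableSet_Ioi).2 (ae_of_all _ fun t ht => le_of_lt ht)
    · rw [ae_dirac_iff measurableSet_Ici]
  · have hx' : 0 < x := hx
    have h1 : HasDerivAt g (α * (lam * x ^ (lam - 1)) +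
        (∫ t in Ioi 0, exp (-(x * t)) ∂μ) * x ^ (lam - 1)) x := by
      refine ((((hasDerivAt_rpow_const (Or.inl hx'.ne')).const_mul α).add_const β).add
        (hasDerivAt_integral_lowerGamma hlam hμ hx').2).congr_of_eventuallyEq ?_
      filter_upwards [Ioi_mem_nhds hx'] with y hy using hgμ y hy
    have h2 : x ^ (1 - lam) * x ^ (lam - 1) = 1 := by rw [← rpow_add hx']; simp
    simp only [Q]
    rw [h1.deriv, integral_add_measure (hi x hx) (hd x), integral_smul_measure, integral_dirac,
      ENNReal.toReal_ofReal (by positivity)]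
    simp only [mul_zero, neg_zero, exp_zero, smul_eq_mul]
    linear_combination (α * lam + ∫ t in Ioi 0, exp (-(x * t)) ∂μ) * h2

lemma exists_representation_of_completelyMonotonic {lam : ℝ} (hlam : 0 < lam) {g : ℝ → ℝ}
    (hg : ContDiffOn ℝ (⊤ : ℕ∞) g (Ioi 0)) (hg0 : ∀ x : ℝ, 0 < x → 0 ≤ g x)
    (h : CompletelyMonotonic fun x => x ^ (1 - lam) * deriv g x) :
    ∃ α β : ℝ, 0 ≤ α ∧ 0 ≤ β ∧ ∃ μ : Measure ℝ,
      (∀ x : ℝ, 0 < x → IntegrableOn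
        (fun t => (∫ u in Ioc 0 (x * t), exp (-u) * u ^ (lam - 1)) * t ^ (-lam)) (Ioi 0) μ) ∧
      ∀ x : ℝ, 0 < x → g x = α * x ^ lam + β + ∫ t in Ioi 0,
        (∫ u in Ioc 0 (x * t), exp (-u) * u ^ (lam - 1)) * t ^ (-lam) ∂μ := by
  obtain ⟨P, hsf, hpos, hP⟩ := h.exists_laplace_measure
  have hsplit : ∀ s : ℝ, 0 < s → ∫ t, exp (-(s * t)) ∂P =
      P.real {0} + ∫ t in Ioi 0, exp (-(s * t)) ∂P := fun s hs => by
    have hr : P.restrict (Ici 0) = P := Measure.restrict_eq_self_of_ae_mem hpos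
    conv_lhs => rw [← hr]
    rw [← Ioi_insert, ← union_singleton, union_comm, setIntegral_union (by simp) measurableSet_Ioi
        (hP s hs).1.integrableOn (hP s hs).1.integrableOn, integral_singleton]
    simp
  have hderiv : ∀ s : ℝ, 0 < s → deriv g s = P.real {0} * s ^ (lam - 1) +
      ∫ t in Ioi 0, exp (-(s * t)) * s ^ (lam - 1) ∂P := fun s hs => by
    have h1 : s ^ (1 - lam) * deriv g s = _ := (hP s hs).2
    have h2 : s ^ (1 - lam) * s ^ (lam - 1) = 1 := by rw [← rpow_add hs]; simp
    rw [hsplit s hs] at h1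
    rw [integral_mul_const]
    linear_combination s ^ (lam - 1) * h1 - deriv g s * h2
  have hgd : ∀ s : ℝ, 0 < s → HasDerivAt g (deriv g s) s := fun s hs =>
    ((hg.differentiableOn (by simp)).differentiableAt (Ioi_mem_nhds hs)).hasDerivAt
  have hg' : ∀ s : ℝ, 0 < s → 0 ≤ deriv g s := fun s hs => by
    rw [hderiv s hs]
    exact add_nonneg (mul_nonneg measureReal_nonneg (rpow_nonneg hs.le _))
      (integral_nonneg fun t => mul_nonneg (exp_pos _).le (rpow_nonneg hs.le _))
  have hmono : MonotoneOn g (Ioi 0) := monotoneOn_of_deriv_nonneg (convex_Ioi 0)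
    hg.continuousOn (by simpa using hg.differentiableOn (by simp)) (by simpa using hg')
  set β := sInf (g '' Ioi 0)
  have hβ : Tendsto g (𝓝[>] 0) (𝓝 β) := hmono.tendsto_nhdsGT
    ⟨0, by rintro _ ⟨y, hy, rfl⟩; exact hg0 y hy⟩
  have hβ0 : 0 ≤ β := Real.sInf_nonneg (by rintro _ ⟨y, hy, rfl⟩; exact hg0 y hy)
  have hcont : ∀ x : ℝ, ContinuousOn (Function.update g 0 β) (Icc 0 x) := fun x => by
    rw [continuousOn_update_iff]
    refine ⟨hg.continuousOn.mono fun y hy => lt_of_le_of_ne hy.1.1 (Ne.symm hy.2), fun _ =>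
      hβ.mono_left (nhdsWithin_mono _ fun y hy => lt_of_le_of_ne hy.1.1 (Ne.symm hy.2))⟩
  have hupd : ∀ s : ℝ, 0 < s → HasDerivAt (Function.update g 0 β) (deriv g s) s := fun s hs => by
    refine (hgd s hs).congr_of_eventuallyEq ?_
    filter_upwards [Ioi_mem_nhds hs] with y hy
    exact Function.update_of_ne (ne_of_gt hy) _ _
  have hinteg : ∀ x : ℝ, IntegrableOn (deriv g) (Ioc 0 x) := fun x =>
    intervalIntegral.integrableOn_deriv_of_nonneg (hcont x) (fun s hs => hupd s hs.1)
      fun s hs => hg' s hs.1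
  have hrpow : ∀ x : ℝ, 0 < x → IntegrableOn (fun s : ℝ => s ^ (lam - 1)) (Ioc 0 x) :=
    fun x hx => (intervalIntegrable_iff_integrableOn_Ioc_of_le hx.le).1
      (intervalIntegral.intervalIntegrable_rpow' (by linarith))
  have hftc : ∀ x : ℝ, 0 < x → ∫ s in Ioc 0 x, deriv g s = g x - β := fun x hx => by
    rw [← intervalIntegral.integral_of_le hx.le,
      intervalIntegral.integral_eq_sub_of_hasDerivAt_of_le hx.le (hcont x)
        (fun s hs => hupd s hs.1)
        ((intervalIntegrable_iff_integrableOn_Ioc_of_le hx.le).2 (hinteg x)),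
      Function.update_of_ne hx.ne', Function.update_self]
  have hprod : ∀ x : ℝ, 0 < x → Integrable
      (fun p : ℝ × ℝ => exp (-(p.1 * p.2)) * p.1 ^ (lam - 1))
      ((volume.restrict (Ioc 0 x)).prod (P.restrict (Ioi 0))) := fun x hx => by
    have hm : Measurable fun p : ℝ × ℝ => exp (-(p.1 * p.2)) * p.1 ^ (lam - 1) := by fun_prop
    rw [integrable_prod_iff hm.aestronglyMeasurable]
    refine ⟨(ae_restrict_iff' measurableSet_Ioc).2 (ae_of_all _ fun s hs =>
      (hP s hs.1).1.integrableOn.mul_const (s ^ (lam - 1))), ?_⟩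
    refine (integrableOn_congr_fun (fun s hs => ?_) measurableSet_Ioc).1
      ((hinteg x).sub ((hrpow x hx).const_mul (P.real {0})))
    simp only [Pi.sub_apply]
    rw [hderiv s hs.1, add_sub_cancel_left]
    refine integral_congr_ae (ae_of_all _ fun t => ?_)
    exact (Real.norm_of_nonneg (mul_nonneg (exp_pos _).le (rpow_nonneg hs.1.le _))).symm
  refine ⟨P.real {0} / lam, β, by positivity, hβ0, P, fun x hx => ?_, fun x hx => ?_⟩
  · exact (integrableOn_congr_fun (fun t ht => (lowerGamma_mul_rpow_eq hx ht).symm)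
      measurableSet_Ioi).1 (hprod x hx).integral_prod_right
  · rw [setIntegral_congr_fun measurableSet_Ioi fun t ht => lowerGamma_mul_rpow_eq hx ht,
      ← integral_integral_swap (hprod x hx)]
    have h1 := hftc x hx
    rw [setIntegral_congr_fun measurableSet_Ioc fun s hs => hderiv s hs.1,
      integral_add ((hrpow x hx).const_mul _) (hprod x hx).integral_prod_left, integral_const_mul,
      ← intervalIntegral.integral_of_le hx.le, integral_rpow (Or.inl (by linarith))] at h1
    simp only [sub_add_cancel, zero_rpow hlam.ne', sub_zero] at h1
    linear_combination -h1

theorem generalized_bernstein (lam : ℝ) (hlam : 0 < lam) (g : ℝ → ℝ)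
    (hg : ContDiffOn ℝ (⊤ : ℕ∞) g (Set.Ioi 0)) (hg0 : ∀ x : ℝ, 0 < x → 0 ≤ g x) :
    CompletelyMonotonic (fun x => x ^ (1 - lam) * deriv g x)
    ↔
    ∃ α β : ℝ, 0 ≤ α ∧ 0 ≤ β ∧ ∃ μ : Measure ℝ,
      (∀ x : ℝ, 0 < x →
        IntegrableOn
          (fun t => (∫ u in Set.Ioc 0 (x * t), Real.exp (-u) * u ^ (lam - 1)) * t ^ (-lam))
          (Set.Ioi 0) μ) ∧
      (∀ x : ℝ, 0 < x →
        g x = α * x ^ lam + β +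
          ∫ t in Set.Ioi 0,
            (∫ u in Set.Ioc 0 (x * t), Real.exp (-u) * u ^ (lam - 1)) * t ^ (-lam) ∂μ) :=
  ⟨exists_representation_of_completelyMonotonic hlam hg hg0,
    fun ⟨_, _, hα, _, _, hμ, hgμ⟩ => completelyMonotonic_of_representation hlam hα hμ hgμ⟩
end
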